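/- Let N ≥ 1 be an integer and 1 < k < ∞. There exists a constant C > 0, depending only on N and k, such that for every R > 0 and every function z that is twice continuously differentiable on an open set containing the closed annulus {x ∈ ℝ^N : R/4 ≤ |x| ≤ 2R}, one has ∫_{R/2 < |x| < R} |D²z(x)|^k dx ≤ C ( ∫_{R/4 < |x| < 2R} |Δz(x)|^k dx + R^{−2k} ∫_{R/4 < |x| < 2R} |z(x)|^k dx ), where |D²z(x)| denotes the norm of the second derivative (Hessian) of z at x. -/

import Mathlib

open MeasureTheory Metric Set Filter

/-- The Euclidean Laplacian of `u : ℝ^N → ℝ`, as the sum of the second derivatives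
along the standard coordinate directions. -/
noncomputable def lap {N : ℕ} (u : EuclideanSpace ℝ (Fin N) → ℝ)
    (x : EuclideanSpace ℝ (Fin N)) : ℝ :=
  ∑ i : Fin N, iteratedFDeriv ℝ 2 u x ![EuclideanSpace.single i 1, EuclideanSpace.single i 1]

/-- `(u, v)` is a positive solution of the Hardy–Hénon system
`-Δu = |x|^a v^p`, `-Δv = |x|^b u^q` on the set `Ω`:
`u, v` are continuous on `Ω`, `C²` on `Ω \ {0}`, positive on `Ω`, and
the equations hold on `Ω \ {0}`. -/
def IsHHSol {N : ℕ} (a b p q : ℝ) (Ω : Set (EuclideanSpace ℝ (Fin N)))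
    (u v : EuclideanSpace ℝ (Fin N) → ℝ) : Prop :=
  ContinuousOn u Ω ∧ ContinuousOn v Ω ∧
  ContDiffOn ℝ 2 u (Ω \ {0}) ∧ ContDiffOn ℝ 2 v (Ω \ {0}) ∧
  (∀ x ∈ Ω, 0 < u x) ∧ (∀ x ∈ Ω, 0 < v x) ∧
  (∀ x ∈ Ω \ {0}, -lap u x = ‖x‖ ^ a * v x ^ p) ∧
  (∀ x ∈ Ω \ {0}, -lap v x = ‖x‖ ^ b * u x ^ q)

open scoped ContDiff Topology

set_option linter.unusedSectionVars false

section Averages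

variable {E : Type*} [NormedAddCommGroup E] [InnerProductSpace ℝ E] [FiniteDimensional ℝ E]
  [MeasurableSpace E] [BorelSpace E]

/-- The derivative of `f` in the direction `v`. -/
noncomputable def dirDeriv (v : E) (f : E → ℝ) (x : E) : ℝ := fderiv ℝ f x v

/-- Smooth functions with compact support. -/
structure IsTest (f : E → ℝ) : Prop where
  contDiff : ContDiff ℝ ∞ f
  hasCompactSupport : HasCompactSupport f

namespace IsTest

variable {f g : E → ℝ}

theorem continuous (hf : IsTest f) : Continuous f := hf.contDiff.continuous

theorem differentiable (hf : IsTest f) : Differentiable ℝ f :=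
  hf.contDiff.differentiable (by simp)

theorem exists_bound (hf : IsTest f) : ∃ C, ∀ x, ‖f x‖ ≤ C :=
  hf.hasCompactSupport.exists_bound_of_continuous hf.continuous

theorem integrable (hf : IsTest f) : Integrable f :=
  hf.continuous.integrable_of_hasCompactSupport hf.hasCompactSupport

theorem dirDeriv (hf : IsTest f) (v : E) : IsTest (dirDeriv v f) where
  contDiff := by
    have : ContDiff ℝ ∞ (fderiv ℝ f) := hf.contDiff.fderiv_right (by simp)
    exact this.clm_apply contDiff_const
  hasCompactSupport := hf.hasCompactSupport.fderiv_apply ℝ v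

theorem sum {ι : Type*} [Fintype ι] {F : ι → E → ℝ} (hF : ∀ i, IsTest (F i)) :
    IsTest (fun x => ∑ i, F i x) where
  contDiff := ContDiff.sum fun i _ => (hF i).contDiff
  hasCompactSupport := by
    have hK : IsCompact (⋃ i, tsupport (F i)) := isCompact_iUnion fun i => (hF i).hasCompactSupport
    refine HasCompactSupport.intro hK fun x hx => ?_
    refine Finset.sum_eq_zero fun i _ => image_eq_zero_of_notMem_tsupport fun h => hx ?_
    exact mem_iUnion.2 ⟨i, h⟩

end IsTest

theorem dirDeriv_sum {ι : Type*} [Fintype ι] {F : ι → E → ℝ} (hF : ∀ i, Differentiable ℝ (F i))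
    (v : E) (x : E) : dirDeriv v (fun x => ∑ i, F i x) x = ∑ i, dirDeriv v (F i) x := by
  simp only [dirDeriv]
  rw [fderiv_fun_sum fun i _ => hF i x]
  simp

theorem dirDeriv_comm {f : E → ℝ} (hf : ContDiff ℝ 2 f) (v w : E) :
    dirDeriv v (dirDeriv w f) = dirDeriv w (dirDeriv v f) := by
  ext x
  have hd : DifferentiableAt ℝ (fderiv ℝ f) x :=
    (hf.fderiv_right (m := 1) (by norm_num)).differentiable (by norm_num) x
  have key : ∀ a b : E, dirDeriv a (dirDeriv b f) x = fderiv ℝ (fderiv ℝ f) x a b := by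
    intro a b
    have : HasFDerivAt (fun y => fderiv ℝ f y b)
        ((ContinuousLinearMap.apply ℝ ℝ b).comp (fderiv ℝ (fderiv ℝ f) x)) x :=
      (ContinuousLinearMap.apply ℝ ℝ b).hasFDerivAt.comp x hd.hasFDerivAt
    change fderiv ℝ (fun y => fderiv ℝ f y b) x a = _
    rw [this.fderiv]
    simp
  rw [key, key]
  exact (hf.contDiffAt.isSymmSndFDerivAt (by simp)).eq v w

/-- The average of `f` at `x` against the image of `ν` under dilation by `s`. -/
noncomputable def dilAvg (ν : Measure E) (f : E → ℝ) (s : ℝ) (x : E) : ℝ :=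
  ∫ y, f (x + s • y) ∂ν

variable {ν : Measure E} [IsProbabilityMeasure ν] {f : E → ℝ}

theorem integrable_comp_dil (hf : Continuous f) {C : ℝ} (hC : ∀ x, ‖f x‖ ≤ C) (s : ℝ) (x : E) :
    Integrable (fun y => f (x + s • y)) ν :=
  Integrable.of_bound (hf.comp (by fun_prop)).aestronglyMeasurable C (ae_of_all _ fun _ => hC _)

theorem continuous_dilAvg (hf : Continuous f) {C : ℝ} (hC : ∀ x, ‖f x‖ ≤ C) :
    Continuous (fun p : ℝ × E => dilAvg ν f p.1 p.2) := by
  refine continuous_of_dominated (bound := fun _ => C) ?_ ?_ (integrable_const _) ?_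
  · intro p
    exact (hf.comp (by fun_prop)).aestronglyMeasurable
  · intro p
    exact ae_of_all _ fun _ => hC _
  · exact ae_of_all _ fun y => hf.comp (by fun_prop)

theorem abs_dilAvg_le {C : ℝ} (hC : ∀ x, ‖f x‖ ≤ C) (s : ℝ) (x : E) : |dilAvg ν f s x| ≤ C := by
  have := norm_integral_le_of_norm_le_const (μ := ν) (ae_of_all _ fun y => hC (x + s • y))
  simpa [dilAvg] using this

theorem dilAvg_nonneg (hf : ∀ x, 0 ≤ f x) (s : ℝ) (x : E) : 0 ≤ dilAvg ν f s x :=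
  integral_nonneg fun _ => hf _

theorem dilAvg_zero (x : E) : dilAvg ν f 0 x = f x := by simp [dilAvg]

theorem dilAvg_sum {ι : Type*} [Fintype ι] {F : ι → E → ℝ} (hF : ∀ i, IsTest (F i))
    (s : ℝ) (x : E) : dilAvg ν (fun x => ∑ i, F i x) s x = ∑ i, dilAvg ν (F i) s x := by
  simp only [dilAvg]
  refine integral_finsetSum _ fun i _ => ?_
  obtain ⟨C, hC⟩ := (hF i).exists_bound
  exact integrable_comp_dil (hF i).continuous hC s x

/-- Jensen's inequality for averages of a function dominated by a concave power. -/
theorem abs_dilAvg_le_rpow {h : E → ℝ} {α : ℝ} (hα : 0 < α) (hα1 : α ≤ 1) (hf : Continuous f)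
    (hh : Continuous h) {C : ℝ} (hC : ∀ x, ‖h x‖ ≤ C) (hh0 : ∀ x, 0 ≤ h x)
    (hfh : ∀ x, |f x| ≤ h x ^ α) (s : ℝ) (x : E) :
    |dilAvg ν f s x| ≤ dilAvg ν h s x ^ α := by
  have hc : Continuous fun x => h x ^ α := hh.rpow_const fun _ => Or.inr hα.le
  have hb : ∀ x, ‖h x ^ α‖ ≤ C ^ α := fun x => by
    rw [Real.norm_of_nonneg (Real.rpow_nonneg (hh0 x) _)]
    exact Real.rpow_le_rpow (hh0 x) ((le_abs_self _).trans (hC x)) hα.le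
  have h1 : |dilAvg ν f s x| ≤ ∫ y, h (x + s • y) ^ α ∂ν := by
    refine (norm_integral_le_integral_norm fun y => f (x + s • y)).trans ?_
    refine integral_mono ?_ (integrable_comp_dil hc hb s x) fun y => hfh _
    exact (integrable_comp_dil hf (C := C ^ α) (fun x => (hfh x).trans
      ((le_abs_self _).trans (hb x))) s x).norm
  refine h1.trans ?_
  exact ConcaveOn.le_map_integral (f := fun y => h (x + s • y)) (Real.concaveOn_rpow hα.le hα1)
    (Real.continuous_rpow_const hα.le).continuousOn isClosed_Ici
    (ae_of_all _ fun y => hh0 _) (integrable_comp_dil hh hC s x) (integrable_comp_dil hc hb s x)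

theorem hasFDerivAt_dilAvg (hf : IsTest f) (s : ℝ) (x : E) :
    HasFDerivAt (dilAvg ν f s) (∫ y, fderiv ℝ f (x + s • y) ∂ν) x := by
  obtain ⟨C, hC⟩ := hf.exists_bound
  have hc' : Continuous (fderiv ℝ f) := hf.contDiff.continuous_fderiv (by simp)
  obtain ⟨C', hC'⟩ := (hf.hasCompactSupport.fderiv ℝ).exists_bound_of_continuous hc'
  refine hasFDerivAt_integral_of_dominated_of_fderiv_le (𝕜 := ℝ)
    (F := fun x y => f (x + s • y)) (F' := fun x y => fderiv ℝ f (x + s • y)) (s := univ)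
    (bound := fun _ => C')
    univ_mem ?_ (integrable_comp_dil hf.continuous hC s x) ?_ ?_ (integrable_const _) ?_
  · exact Eventually.of_forall fun x => (hf.continuous.comp (by fun_prop)).aestronglyMeasurable
  · exact (hc'.comp (by fun_prop)).aestronglyMeasurable
  · exact ae_of_all _ fun y x _ => hC' _
  · refine ae_of_all _ fun y x _ => ?_
    exact (hasFDerivAt_comp_add_right (s • y)).2 (hf.differentiable (x + s • y)).hasFDerivAt

theorem differentiable_dilAvg (hf : IsTest f) (s : ℝ) : Differentiable ℝ (dilAvg ν f s) :=
  fun x => (hasFDerivAt_dilAvg hf s x).differentiableAt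

theorem dirDeriv_dilAvg (hf : IsTest f) (v : E) (s : ℝ) :
    dirDeriv v (dilAvg ν f s) = dilAvg ν (dirDeriv v f) s := by
  ext x
  have hc' : Continuous (fderiv ℝ f) := hf.contDiff.continuous_fderiv (by simp)
  obtain ⟨C', hC'⟩ := (hf.hasCompactSupport.fderiv ℝ).exists_bound_of_continuous hc'
  rw [dirDeriv, (hasFDerivAt_dilAvg hf s x).fderiv, ContinuousLinearMap.integral_apply]
  · rfl
  · exact Integrable.of_bound (hc'.comp (by fun_prop)).aestronglyMeasurable C'
      (ae_of_all _ fun _ => hC' _)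

theorem lintegral_dilAvg_le (hf : Continuous f) (s : ℝ) :
    ∫⁻ x, ‖dilAvg ν f s x‖ₑ ≤ ∫⁻ x, ‖f x‖ₑ := by
  calc ∫⁻ x, ‖dilAvg ν f s x‖ₑ ≤ ∫⁻ x, ∫⁻ y, ‖f (x + s • y)‖ₑ ∂ν :=
        lintegral_mono fun x => enorm_integral_le_lintegral_enorm _
    _ = ∫⁻ y, ∫⁻ x, ‖f (x + s • y)‖ₑ ∂volume ∂ν := by
        refine lintegral_lintegral_swap (Continuous.aemeasurable ?_)
        exact (hf.comp (by fun_prop)).enorm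
    _ = ∫⁻ x, ‖f x‖ₑ := by
        simp [lintegral_add_right_eq_self (fun x => ‖f x‖ₑ)]

theorem integrable_dilAvg (hf : IsTest f) (s : ℝ) : Integrable (dilAvg ν f s) := by
  obtain ⟨C, hC⟩ := hf.exists_bound
  refine ⟨((continuous_dilAvg hf.continuous hC).comp
    (Continuous.prodMk_right s)).aestronglyMeasurable, ?_⟩
  exact (lintegral_dilAvg_le hf.continuous s).trans_lt hf.integrable.2

theorem integral_abs_dilAvg_le (hf : IsTest f) (s : ℝ) :
    ∫ x, |dilAvg ν f s x| ≤ ∫ x, |f x| := by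
  have h1 := integral_norm_eq_lintegral_enorm (integrable_dilAvg (ν := ν) hf s).1
  have h2 := integral_norm_eq_lintegral_enorm hf.integrable.1
  simp only [Real.norm_eq_abs] at h1 h2
  rw [h1, h2]
  exact ENNReal.toReal_mono hf.integrable.2.ne (lintegral_dilAvg_le hf.continuous s)

end Averages

section Gaussian

variable {E : Type*} [NormedAddCommGroup E] [InnerProductSpace ℝ E] [FiniteDimensional ℝ E]
  [MeasurableSpace E] [BorelSpace E]

/-- The density of the standard Gaussian probability measure on `E`. -/
noncomputable def gaussDensity (y : E) : ℝ :=
  (∫ z : E, Real.exp (-(1 / 2) * ‖z‖ ^ 2))⁻¹ * Real.exp (-(1 / 2) * ‖y‖ ^ 2)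

/-- The standard Gaussian probability measure on `E`. -/
noncomputable def gaussMeasure (E : Type*) [NormedAddCommGroup E] [InnerProductSpace ℝ E]
    [FiniteDimensional ℝ E] [MeasurableSpace E] [BorelSpace E] : Measure E :=
  volume.withDensity fun y => ENNReal.ofReal (gaussDensity y)

theorem integral_exp_neg_mul_sq_norm_pos {c : ℝ} (hc : 0 < c) :
    0 < ∫ z : E, Real.exp (-c * ‖z‖ ^ 2) := by
  rw [GaussianFourier.integral_rexp_neg_mul_sq_norm hc]
  positivity

theorem integrable_exp_neg_mul_sq_norm {c : ℝ} (hc : 0 < c) :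
    Integrable fun z : E => Real.exp (-c * ‖z‖ ^ 2) := by
  by_contra h
  exact (integral_exp_neg_mul_sq_norm_pos (E := E) hc).ne' (integral_undef h)

theorem gaussDensity_nonneg (y : E) : 0 ≤ gaussDensity y := by
  have := integral_exp_neg_mul_sq_norm_pos (E := E) (c := 1 / 2) (by norm_num)
  unfold gaussDensity
  positivity

theorem continuous_gaussDensity : Continuous (gaussDensity : E → ℝ) := by
  unfold gaussDensity
  fun_prop

theorem integrable_gaussDensity : Integrable (gaussDensity : E → ℝ) :=
  (integrable_exp_neg_mul_sq_norm (by norm_num)).const_mul _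

theorem integrable_norm_mul_gaussDensity :
    Integrable fun y : E => ‖y‖ * gaussDensity y := by
  have h := ((integrable_exp_neg_mul_sq_norm (E := E) (c := 1 / 4) (by norm_num)).const_mul
    (∫ z : E, Real.exp (-(1 / 2) * ‖z‖ ^ 2))⁻¹)
  refine h.mono' (continuous_norm.mul continuous_gaussDensity).aestronglyMeasurable
    (ae_of_all _ fun y => ?_)
  have hZ := integral_exp_neg_mul_sq_norm_pos (E := E) (c := 1 / 2) (by norm_num)
  rw [Real.norm_of_nonneg (mul_nonneg (norm_nonneg _) (gaussDensity_nonneg _)), gaussDensity,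
    mul_left_comm]
  refine mul_le_mul_of_nonneg_left ?_ (inv_nonneg.2 hZ.le)
  have h1 : ‖y‖ ≤ Real.exp (1 / 4 * ‖y‖ ^ 2) := by
    have := Real.add_one_le_exp (1 / 4 * ‖y‖ ^ 2)
    nlinarith [sq_nonneg (‖y‖ / 2 - 1)]
  calc ‖y‖ * Real.exp (-(1 / 2) * ‖y‖ ^ 2)
      ≤ Real.exp (1 / 4 * ‖y‖ ^ 2) * Real.exp (-(1 / 2) * ‖y‖ ^ 2) := by gcongr
    _ = Real.exp (-(1 / 4) * ‖y‖ ^ 2) := by rw [← Real.exp_add]; ring_nf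

theorem hasFDerivAt_gaussDensity (y : E) :
    HasFDerivAt gaussDensity (-gaussDensity y • innerSL ℝ y) y := by
  have h1 : HasFDerivAt (fun y : E => -(1 / 2) * ‖y‖ ^ 2) (-(1 / 2 : ℝ) • (2 • innerSL ℝ y)) y :=
    (hasStrictFDerivAt_norm_sq y).hasFDerivAt.const_mul _
  have h2 := (h1.exp).const_mul (∫ z : E, Real.exp (-(1 / 2) * ‖z‖ ^ 2))⁻¹
  refine h2.congr_fderiv ?_
  ext v
  simp [gaussDensity]
  ring

instance isProbabilityMeasure_gaussMeasure : IsProbabilityMeasure (gaussMeasure E) where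
  measure_univ := by
    rw [gaussMeasure, withDensity_apply _ MeasurableSet.univ, Measure.restrict_univ,
      ← ofReal_integral_eq_lintegral_ofReal integrable_gaussDensity
        (ae_of_all _ gaussDensity_nonneg)]
    simp only [gaussDensity]
    rw [integral_const_mul, inv_mul_cancel₀, ENNReal.ofReal_one]
    exact (integral_exp_neg_mul_sq_norm_pos (by norm_num)).ne'

theorem integral_gaussMeasure (F : E → ℝ) :
    ∫ y, F y ∂gaussMeasure E = ∫ y, F y * gaussDensity y := by
  rw [gaussMeasure, integral_withDensity_eq_integral_toReal_smul
    (by exact continuous_gaussDensity.measurable.ennreal_ofReal) (ae_of_all _ fun _ => by simp)]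
  refine integral_congr_ae (ae_of_all _ fun y => ?_)
  simp [ENNReal.toReal_ofReal (gaussDensity_nonneg y), mul_comm]

theorem integrable_gaussMeasure_iff {F : E → ℝ} :
    Integrable F (gaussMeasure E) ↔ Integrable fun y => F y * gaussDensity y := by
  rw [gaussMeasure, integrable_withDensity_iff continuous_gaussDensity.measurable.ennreal_ofReal
    (ae_of_all _ fun _ => by simp)]
  simp [ENNReal.toReal_ofReal (gaussDensity_nonneg _)]

theorem integrable_norm_gaussMeasure : Integrable (fun y : E => ‖y‖) (gaussMeasure E) :=
  integrable_gaussMeasure_iff.2 integrable_norm_mul_gaussDensity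

/-- Gaussian integration by parts. -/
theorem integral_inner_mul_gaussMeasure {F : E → ℝ} (hF : Differentiable ℝ F) {C C' : ℝ}
    (hC : ∀ y, ‖F y‖ ≤ C) (v : E) (hc : Continuous (dirDeriv v F))
    (hC' : ∀ y, ‖dirDeriv v F y‖ ≤ C') :
    ∫ y, inner ℝ y v * F y ∂gaussMeasure E = ∫ y, dirDeriv v F y ∂gaussMeasure E := by
  have hρ : ∀ y : E, fderiv ℝ gaussDensity y v = -(gaussDensity y * inner ℝ y v) := fun y => by
    rw [(hasFDerivAt_gaussDensity y).fderiv]; simp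
  have h := integral_mul_fderiv_eq_neg_fderiv_mul_of_integrable (μ := (volume : Measure E))
    (f := F) (g := gaussDensity) (v := v) ?_ ?_ ?_ (fun x _ => hF x)
    (fun x _ => (hasFDerivAt_gaussDensity x).differentiableAt)
  · rw [integral_gaussMeasure, integral_gaussMeasure]
    simp only [hρ, mul_neg, integral_neg, neg_inj] at h
    simp only [dirDeriv]
    rw [← h]
    congr 1; ext y; ring
  · exact integrable_gaussDensity.bdd_mul hc.aestronglyMeasurable (ae_of_all _ hC')
  · simp only [hρ]
    refine Integrable.bdd_mul (c := C) ?_ hF.continuous.aestronglyMeasurable (ae_of_all _ hC)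
    refine (integrable_norm_mul_gaussDensity.const_mul ‖v‖).mono' (Continuous.aestronglyMeasurable
      (continuous_gaussDensity.mul (by fun_prop)).neg) (ae_of_all _ fun y => ?_)
    rw [norm_neg, norm_mul, Real.norm_of_nonneg (gaussDensity_nonneg y), mul_comm, ← mul_assoc,
      mul_comm ‖v‖]
    exact mul_le_mul_of_nonneg_right (norm_inner_le_norm _ _) (gaussDensity_nonneg y)
  · exact integrable_gaussDensity.bdd_mul hF.continuous.aestronglyMeasurable (ae_of_all _ hC)

variable {f : E → ℝ}

theorem integral_inner_mul_comp_dil (hf : IsTest f) (v : E) (s : ℝ) (x : E) :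
    ∫ y, inner ℝ y v * f (x + s • y) ∂gaussMeasure E
      = s * dilAvg (gaussMeasure E) (dirDeriv v f) s x := by
  obtain ⟨C, hC⟩ := hf.exists_bound
  obtain ⟨C', hC'⟩ := (hf.dirDeriv v).exists_bound
  have hd : ∀ y, HasFDerivAt (fun y => f (x + s • y)) (s • fderiv ℝ f (x + s • y)) y := fun y => by
    have h1 : HasFDerivAt (fun y : E => x + s • y) (s • ContinuousLinearMap.id ℝ E) y :=
      ((hasFDerivAt_id y).const_smul s).const_add x
    refine ((hf.differentiable (x + s • y)).hasFDerivAt.comp y h1).congr_fderiv ?_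
    ext v; simp
  have hd' : ∀ y, dirDeriv v (fun y => f (x + s • y)) y = s * dirDeriv v f (x + s • y) := fun y => by
    rw [dirDeriv, (hd y).fderiv]; simp [dirDeriv]
  rw [integral_inner_mul_gaussMeasure (fun y => (hd y).differentiableAt) (fun y => hC _) v
    (C' := |s| * C')]
  · simp_rw [hd', dilAvg, integral_const_mul]
  · rw [show dirDeriv v (fun y => f (x + s • y)) = fun y => s * dirDeriv v f (x + s • y) from
      funext hd']
    exact continuous_const.mul ((hf.dirDeriv v).continuous.comp (by fun_prop))
  · intro y
    rw [hd', norm_mul]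
    exact mul_le_mul_of_nonneg_left (hC' _) (abs_nonneg _)

/-- The heat flow decays on derivatives of test functions. -/
theorem exists_abs_dilAvg_dirDeriv_le (hf : IsTest f) (v : E) :
    ∃ C, ∀ s x, |s * dilAvg (gaussMeasure E) (dirDeriv v f) s x| ≤ C := by
  obtain ⟨C, hC⟩ := hf.exists_bound
  refine ⟨∫ y : E, ‖y‖ * ‖v‖ * C ∂gaussMeasure E, fun s x => ?_⟩
  rw [← integral_inner_mul_comp_dil hf]
  refine norm_integral_le_of_norm_le (f := fun y => inner ℝ y v * f (x + s • y))
    (((integrable_norm_gaussMeasure (E := E)).mul_const _).mul_const _)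
    (ae_of_all _ fun y => ?_)
  rw [norm_mul]
  gcongr
  · exact norm_inner_le_norm _ _
  · exact hC _

variable {ι : Type*} [Fintype ι] (b : OrthonormalBasis ι ℝ E)

/-- The Laplacian computed in an orthonormal basis. -/
noncomputable def basisLaplacian (f : E → ℝ) (x : E) : ℝ :=
  ∑ i, dirDeriv (b i) (dirDeriv (b i) f) x

theorem IsTest.basisLaplacian (hf : IsTest f) : IsTest (basisLaplacian b f) :=
  IsTest.sum fun i => (hf.dirDeriv (b i)).dirDeriv (b i)

/-- The heat equation, in the time variable `s` with `t = s ^ 2 / 2`. -/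
theorem hasDerivAt_dilAvg (hf : IsTest f) (s : ℝ) (x : E) :
    HasDerivAt (fun s => dilAvg (gaussMeasure E) f s x)
      (s * dilAvg (gaussMeasure E) (basisLaplacian b f) s x) s := by
  obtain ⟨C, hC⟩ := hf.exists_bound
  have hc' : Continuous (fderiv ℝ f) := hf.contDiff.continuous_fderiv (by simp)
  obtain ⟨C', hC'⟩ := (hf.hasCompactSupport.fderiv ℝ).exists_bound_of_continuous hc'
  have key := hasDerivAt_integral_of_dominated_loc_of_deriv_le (𝕜 := ℝ) (μ := gaussMeasure E)
    (F := fun s y => f (x + s • y)) (F' := fun s y => fderiv ℝ f (x + s • y) y) (x₀ := s)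
    (s := univ) (bound := fun y => C' * ‖y‖) univ_mem ?_ (integrable_comp_dil hf.continuous hC s x)
    ?_ ?_ (integrable_norm_gaussMeasure.const_mul _) ?_
  · refine key.2.congr_deriv ?_
    have hexp : ∀ y, fderiv ℝ f (x + s • y) y
        = ∑ i, inner ℝ y (b i) * dirDeriv (b i) f (x + s • y) := fun y => by
      conv_lhs => rw [← b.sum_repr y]
      rw [map_sum]
      refine Finset.sum_congr rfl fun i _ => ?_
      rw [map_smul, b.repr_apply_apply, real_inner_comm, smul_eq_mul, b.sum_repr]
      rfl
    rw [integral_congr_ae (ae_of_all _ hexp), integral_finsetSum]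
    · unfold basisLaplacian
      rw [dilAvg_sum fun i => (hf.dirDeriv (b i)).dirDeriv (b i), Finset.mul_sum]
      refine Finset.sum_congr rfl fun i _ => ?_
      rw [integral_inner_mul_comp_dil (hf.dirDeriv (b i))]
    · intro i _
      obtain ⟨D, hD⟩ := (hf.dirDeriv (b i)).exists_bound
      refine Integrable.mul_bdd (c := D) ?_ ((hf.dirDeriv (b i)).continuous.comp
        (by fun_prop)).aestronglyMeasurable (ae_of_all _ fun y => hD _)
      refine integrable_norm_gaussMeasure.mono' (by fun_prop) (ae_of_all _ fun y => ?_)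
      simpa using norm_inner_le_norm (𝕜 := ℝ) y (b i)
  · exact Eventually.of_forall fun s => (hf.continuous.comp (by fun_prop)).aestronglyMeasurable
  · exact ((hc'.comp (by fun_prop)).clm_apply continuous_id).aestronglyMeasurable
  · exact ae_of_all _ fun y s _ => (ContinuousLinearMap.le_opNorm _ _).trans
      (mul_le_mul_of_nonneg_right (hC' _) (norm_nonneg _))
  · refine ae_of_all _ fun y s _ => ?_
    have h1 : HasDerivAt (fun s : ℝ => x + s • y) y s := by
      simpa using ((hasDerivAt_id s).smul_const y).const_add x
    exact (hf.differentiable (x + s • y)).hasFDerivAt.comp_hasDerivAt s h1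

end Gaussian

section HeatFlow

variable {E : Type*} [NormedAddCommGroup E] [InnerProductSpace ℝ E] [FiniteDimensional ℝ E]
  [MeasurableSpace E] [BorelSpace E]

/-- The heat flow started from `f`, at time `s ^ 2 / 2`. -/
noncomputable abbrev heat (f : E → ℝ) (s : ℝ) (x : E) : ℝ := dilAvg (gaussMeasure E) f s x

theorem IsTest.continuous_heat {f : E → ℝ} (hf : IsTest f) :
    Continuous fun p : ℝ × E => heat f p.1 p.2 := by
  obtain ⟨C, hC⟩ := hf.exists_bound
  exact continuous_dilAvg hf.continuous hC

theorem integrable_heat_mul_heat {a c : E → ℝ} (ha : IsTest a) (hc : IsTest c) (s : ℝ) :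
    Integrable fun x => heat a s x * heat c s x := by
  obtain ⟨C, hC⟩ := ha.exists_bound
  exact (integrable_dilAvg hc s).bdd_mul (c := C)
    (integrable_dilAvg ha s).1 (ae_of_all _ fun x => abs_dilAvg_le hC s x)

theorem integrable_prod_heat_mul_heat {a c : E → ℝ} (ha : IsTest a) (hc : IsTest c) (S : ℝ) :
    Integrable (fun p : ℝ × E => p.1 * (heat a p.1 p.2 * heat c p.1 p.2))
      ((volume.restrict (Ioc 0 S)).prod volume) := by
  obtain ⟨C, hC⟩ := ha.exists_bound
  have hcont : Continuous fun p : ℝ × E => p.1 * (heat a p.1 p.2 * heat c p.1 p.2) :=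
    continuous_fst.mul (ha.continuous_heat.mul hc.continuous_heat)
  rw [integrable_prod_iff hcont.aestronglyMeasurable]
  refine ⟨ae_of_all _ fun s => (integrable_heat_mul_heat ha hc s).const_mul s, ?_⟩
  refine Integrable.of_bound (C := S * (C * ∫ x, |c x|))
    hcont.norm.aestronglyMeasurable.integral_prod_right' ?_
  filter_upwards [ae_restrict_mem measurableSet_Ioc] with s hs
  have hC0 : 0 ≤ C := (norm_nonneg _).trans (hC 0)
  rw [Real.norm_of_nonneg (integral_nonneg fun _ => norm_nonneg _)]
  calc ∫ x, ‖s * (heat a s x * heat c s x)‖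
      = s * ∫ x, ‖heat a s x * heat c s x‖ := by
        simp_rw [norm_mul s, integral_const_mul, Real.norm_of_nonneg hs.1.le]
    _ ≤ S * ∫ x, ‖heat a s x * heat c s x‖ :=
        mul_le_mul_of_nonneg_right hs.2 (integral_nonneg fun _ => norm_nonneg _)
    _ ≤ S * ∫ x, C * |heat c s x| := by
        refine mul_le_mul_of_nonneg_left ?_ (hs.1.le.trans hs.2)
        refine integral_mono (integrable_heat_mul_heat ha hc s).norm
          ((integrable_dilAvg hc s).abs.const_mul C) fun x => ?_
        simp only [norm_mul]
        exact mul_le_mul_of_nonneg_right (abs_dilAvg_le hC s x) (norm_nonneg _)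
    _ ≤ S * (C * ∫ x, |c x|) := by
        rw [integral_const_mul]
        exact mul_le_mul_of_nonneg_left
          (mul_le_mul_of_nonneg_left (integral_abs_dilAvg_le hc s) hC0) (hs.1.le.trans hs.2)

theorem integral_sub_integral_eq_of_hasDerivAt {F F' : ℝ → E → ℝ} {S : ℝ} (hS : 0 ≤ S)
    (hF : ∀ s x, HasDerivAt (fun s => F s x) (F' s x) s)
    (hc : Continuous fun p : ℝ × E => F' p.1 p.2)
    (hi : Integrable (fun p : ℝ × E => F' p.1 p.2) ((volume.restrict (Ioc 0 S)).prod volume))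
    (h0 : Integrable (F 0)) (hS' : Integrable (F S)) :
    (∫ x, F S x) - ∫ x, F 0 x = ∫ s in Ioc 0 S, ∫ x, F' s x := by
  rw [integral_integral_swap (by exact hi), ← integral_sub hS' h0]
  congr 1
  ext x
  rw [← intervalIntegral.integral_of_le hS]
  refine (intervalIntegral.integral_eq_sub_of_hasDerivAt (fun s _ => hF s x) ?_).symm
  exact (hc.comp (Continuous.prodMk_left x)).intervalIntegrable _ _

theorem integral_heat_mul_heat_dirDeriv {a c : E → ℝ} (ha : IsTest a) (hc : IsTest c) (v : E)
    (s : ℝ) :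
    ∫ x, heat a s x * heat (dirDeriv v c) s x = -∫ x, heat (dirDeriv v a) s x * heat c s x := by
  have e : ∀ {f : E → ℝ}, IsTest f → ∀ x, fderiv ℝ (heat f s) x v = heat (dirDeriv v f) s x :=
    fun hf x => congrFun (dirDeriv_dilAvg hf v s) x
  have h := integral_mul_fderiv_eq_neg_fderiv_mul_of_integrable (μ := (volume : Measure E))
    (f := heat a s) (g := heat c s) (v := v) ?_ ?_ (integrable_heat_mul_heat ha hc s)
    (fun x _ => differentiable_dilAvg ha s x) (fun x _ => differentiable_dilAvg hc s x)
  · simpa only [e ha, e hc] using h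
  · simpa only [e ha] using integrable_heat_mul_heat (ha.dirDeriv v) hc s
  · simpa only [e hc] using integrable_heat_mul_heat ha (hc.dirDeriv v) s

variable {ι : Type*} [Fintype ι] (b : OrthonormalBasis ι ℝ E)

theorem basisLaplacian_dirDeriv {u : E → ℝ} (hu : IsTest u) (v : E) :
    basisLaplacian b (dirDeriv v u) = dirDeriv v (basisLaplacian b u) := by
  ext x
  unfold basisLaplacian
  rw [dirDeriv_sum fun i => ((hu.dirDeriv _).dirDeriv _).differentiable]
  refine Finset.sum_congr rfl fun i _ => ?_
  have h2 : ∀ {g : E → ℝ}, IsTest g → ContDiff ℝ 2 g := fun hg =>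
    contDiff_infty.1 hg.contDiff 2
  rw [dirDeriv_comm (h2 hu) (b i) v, dirDeriv_comm (h2 (hu.dirDeriv _)) (b i) v]

theorem integral_heat_mul_heat_basisLaplacian {a c : E → ℝ} (ha : IsTest a) (hc : IsTest c)
    (s : ℝ) :
    ∫ x, heat a s x * heat (basisLaplacian b c) s x
      = ∫ x, heat (basisLaplacian b a) s x * heat c s x := by
  have h1 : ∀ x, heat a s x * heat (basisLaplacian b c) s x
      = ∑ i, heat a s x * heat (dirDeriv (b i) (dirDeriv (b i) c)) s x := fun x => by
    rw [← Finset.mul_sum, heat, heat]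
    unfold basisLaplacian
    rw [dilAvg_sum fun i => (hc.dirDeriv (b i)).dirDeriv (b i)]
  have h2 : ∀ x, heat (basisLaplacian b a) s x * heat c s x
      = ∑ i, heat (dirDeriv (b i) (dirDeriv (b i) a)) s x * heat c s x := fun x => by
    rw [← Finset.sum_mul, heat, heat]
    unfold basisLaplacian
    rw [dilAvg_sum fun i => (ha.dirDeriv (b i)).dirDeriv (b i)]
  simp_rw [h1, h2]
  rw [integral_finsetSum _ fun i _ => integrable_heat_mul_heat ha ((hc.dirDeriv _).dirDeriv _) s,
    integral_finsetSum _ fun i _ => integrable_heat_mul_heat ((ha.dirDeriv _).dirDeriv _) hc s]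
  refine Finset.sum_congr rfl fun i _ => ?_
  rw [integral_heat_mul_heat_dirDeriv ha (hc.dirDeriv _),
    integral_heat_mul_heat_dirDeriv (ha.dirDeriv _) hc, neg_neg]

theorem integral_mul_eq_heat {a g : E → ℝ} (ha : IsTest a) (hg : IsTest g) {S : ℝ} (hS : 0 ≤ S) :
    ∫ x, a x * g x = (∫ x, heat a S x * heat g S x)
      - 2 * ∫ s in Ioc 0 S, s * ∫ x, heat (basisLaplacian b a) s x * heat g s x := by
  have hLa := ha.basisLaplacian b
  have hLg := hg.basisLaplacian b
  have h := integral_sub_integral_eq_of_hasDerivAt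
    (F := fun s x => heat a s x * heat g s x)
    (F' := fun s x => s * (heat (basisLaplacian b a) s x * heat g s x)
      + s * (heat a s x * heat (basisLaplacian b g) s x)) hS ?_ ?_ ?_
      (integrable_heat_mul_heat ha hg 0) (integrable_heat_mul_heat ha hg S)
  · have h2 : ∀ s, ∫ x, (s * (heat (basisLaplacian b a) s x * heat g s x)
        + s * (heat a s x * heat (basisLaplacian b g) s x))
        = 2 * (s * ∫ x, heat (basisLaplacian b a) s x * heat g s x) := fun s => by
      rw [integral_add ((integrable_heat_mul_heat hLa hg s).const_mul s)
        ((integrable_heat_mul_heat ha hLg s).const_mul s), integral_const_mul, integral_const_mul,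
        integral_heat_mul_heat_basisLaplacian b ha hg]
      ring
    simp only [h2, integral_const_mul, heat, dilAvg_zero] at h
    simp only [heat]
    linarith
  · intro s x
    refine ((hasDerivAt_dilAvg b ha s x).mul (hasDerivAt_dilAvg b hg s x)).congr_deriv ?_
    ring
  · exact (continuous_fst.mul (hLa.continuous_heat.mul hg.continuous_heat)).add
      (continuous_fst.mul (ha.continuous_heat.mul hLg.continuous_heat))
  · exact (integrable_prod_heat_mul_heat hLa hg S).add (integrable_prod_heat_mul_heat ha hLg S)

/-- Second derivatives are paired with test functions through a square function of the heat flow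
of the Laplacian. -/
theorem abs_integral_dirDeriv_mul_le {u g : E → ℝ} (hu : IsTest u) (hg : IsTest g) (v w : E)
    {K : ℝ} (hK : ∀ S > 0, |∫ s in Ioc 0 S, s * ∫ x,
      heat (dirDeriv w (basisLaplacian b u)) s x * heat (dirDeriv v g) s x| ≤ K) :
    |∫ x, dirDeriv v (dirDeriv w u) x * g x| ≤ 2 * K := by
  obtain ⟨C, hC⟩ := exists_abs_dilAvg_dirDeriv_le (hu.dirDeriv w) v
  have hf := hu.basisLaplacian b
  have hS : ∀ S > 0, |∫ x, dirDeriv v (dirDeriv w u) x * g x| ≤ C * (∫ x, |g x|) / S + 2 * K := by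
    intro S hS
    have h1 := integral_mul_eq_heat b ((hu.dirDeriv w).dirDeriv v) hg hS.le
    have h2 : ∀ s, ∫ x, heat (basisLaplacian b (dirDeriv v (dirDeriv w u))) s x * heat g s x
        = -∫ x, heat (dirDeriv w (basisLaplacian b u)) s x * heat (dirDeriv v g) s x := fun s => by
      rw [basisLaplacian_dirDeriv b (hu.dirDeriv w), basisLaplacian_dirDeriv b hu,
        integral_heat_mul_heat_dirDeriv (hf.dirDeriv w) hg, neg_neg]
    simp only [h2, mul_neg, integral_neg] at h1
    have h3 : |∫ x, heat (dirDeriv v (dirDeriv w u)) S x * heat g S x|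
        ≤ C * (∫ x, |g x|) / S := by
      have hb : ∀ x, |heat (dirDeriv v (dirDeriv w u)) S x| ≤ C / S := fun x => by
        have := hC S x
        rw [abs_mul, abs_of_pos hS] at this
        rw [le_div_iff₀ hS]
        linarith
      have hC0 : 0 ≤ C / S := (abs_nonneg _).trans (hb 0)
      calc |∫ x, heat (dirDeriv v (dirDeriv w u)) S x * heat g S x|
          ≤ ∫ x, C / S * |heat g S x| := by
            refine norm_integral_le_of_norm_le
              (f := fun x => heat (dirDeriv v (dirDeriv w u)) S x * heat g S x)
              ((integrable_dilAvg (ν := gaussMeasure E) hg S).abs.const_mul (C / S))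
              (ae_of_all _ fun x => ?_)
            rw [norm_mul]
            exact mul_le_mul_of_nonneg_right (hb x) (norm_nonneg _)
        _ ≤ C / S * ∫ x, |g x| := by
            rw [integral_const_mul]
            exact mul_le_mul_of_nonneg_left (integral_abs_dilAvg_le hg S) hC0
        _ = _ := by ring
    rw [h1]
    rw [sub_neg_eq_add]
    refine (abs_add_le _ _).trans (add_le_add h3 ?_)
    rw [abs_mul, abs_two]
    exact mul_le_mul_of_nonneg_left (hK S hS) (by norm_num)
  have hlim : Tendsto (fun S : ℝ => C * (∫ x, |g x|) / S + 2 * K) atTop (𝓝 (0 + 2 * K)) :=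
    (tendsto_const_nhds.div_atTop tendsto_id).add_const _
  rw [zero_add] at hlim
  exact ge_of_tendsto hlim ((eventually_gt_atTop 0).mono hS)

end HeatFlow

section Bellman

variable {E : Type*} [NormedAddCommGroup E] [InnerProductSpace ℝ E] [FiniteDimensional ℝ E]
  [MeasurableSpace E] [BorelSpace E] {ι : Type*} [Fintype ι] {b : OrthonormalBasis ι ℝ E}

/-- `P` solves the heat equation with sink `Q`, in the time variable `s` with `t = s ^ 2 / 2`;
`P₁` and `P₂` are the pure first and second derivatives along the basis `b`. -/
structure IsHeatFlow (b : OrthonormalBasis ι ℝ E) (P : ℝ → E → ℝ) (P₁ P₂ : ι → ℝ → E → ℝ)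
    (Q : ℝ → E → ℝ) : Prop where
  cont : Continuous fun p : ℝ × E => P p.1 p.2
  cont₁ : ∀ i, Continuous fun p : ℝ × E => P₁ i p.1 p.2
  cont₂ : ∀ i, Continuous fun p : ℝ × E => P₂ i p.1 p.2
  contQ : Continuous fun p : ℝ × E => Q p.1 p.2
  deriv₁ : ∀ i s x, HasLineDerivAt ℝ (P s) (P₁ i s x) x (b i)
  deriv₂ : ∀ i s x, HasLineDerivAt ℝ (P₁ i s) (P₂ i s x) x (b i)
  deriv_time : ∀ s x, HasDerivAt (fun s => P s x) (s * ((∑ i, P₂ i s x) - Q s x)) s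

namespace IsHeatFlow

variable {P P' : ℝ → E → ℝ} {P₁ P₂ P₁' P₂' : ι → ℝ → E → ℝ} {Q Q' : ℝ → E → ℝ}

theorem add (h : IsHeatFlow b P P₁ P₂ Q) (h' : IsHeatFlow b P' P₁' P₂' Q') :
    IsHeatFlow b (fun s x => P s x + P' s x) (fun i s x => P₁ i s x + P₁' i s x)
      (fun i s x => P₂ i s x + P₂' i s x) (fun s x => Q s x + Q' s x) where
  cont := h.cont.add h'.cont
  cont₁ i := (h.cont₁ i).add (h'.cont₁ i)
  cont₂ i := (h.cont₂ i).add (h'.cont₂ i)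
  contQ := h.contQ.add h'.contQ
  deriv₁ i s x := (h.deriv₁ i s x).add (h'.deriv₁ i s x)
  deriv₂ i s x := (h.deriv₂ i s x).add (h'.deriv₂ i s x)
  deriv_time s x := by
    refine ((h.deriv_time s x).add (h'.deriv_time s x)).congr_deriv ?_
    rw [Finset.sum_add_distrib]; ring

theorem const_mul (c : ℝ) (h : IsHeatFlow b P P₁ P₂ Q) :
    IsHeatFlow b (fun s x => c * P s x) (fun i s x => c * P₁ i s x)
      (fun i s x => c * P₂ i s x) (fun s x => c * Q s x) where
  cont := continuous_const.mul h.cont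
  cont₁ i := continuous_const.mul (h.cont₁ i)
  cont₂ i := continuous_const.mul (h.cont₂ i)
  contQ := continuous_const.mul h.contQ
  deriv₁ i s x := HasDerivAt.const_mul c (h.deriv₁ i s x)
  deriv₂ i s x := HasDerivAt.const_mul c (h.deriv₂ i s x)
  deriv_time s x := by
    refine ((h.deriv_time s x).const_mul c).congr_deriv ?_
    rw [← Finset.mul_sum]; ring

theorem const (c : ℝ) : IsHeatFlow b (fun _ _ => c) (fun _ _ _ => 0) (fun _ _ _ => 0)
    (fun _ _ => 0) where
  cont := continuous_const
  cont₁ _ := continuous_const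
  cont₂ _ := continuous_const
  contQ := continuous_const
  deriv₁ _ _ _ := hasDerivAt_const _ _
  deriv₂ _ _ _ := hasDerivAt_const _ _
  deriv_time s x := (hasDerivAt_const _ _).congr_deriv (by simp)

theorem heat {f : E → ℝ} (hf : IsTest f) :
    IsHeatFlow b (heat f) (fun i => heat (dirDeriv (b i) f))
      (fun i => _root_.heat (dirDeriv (b i) (dirDeriv (b i) f))) (fun _ _ => 0) where
  cont := hf.continuous_heat
  cont₁ i := (hf.dirDeriv (b i)).continuous_heat
  cont₂ i := ((hf.dirDeriv (b i)).dirDeriv (b i)).continuous_heat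
  contQ := continuous_const
  deriv₁ i s x := by
    rw [_root_.heat, ← dirDeriv_dilAvg hf]
    exact (differentiable_dilAvg hf s x).hasFDerivAt.hasLineDerivAt _
  deriv₂ i s x := by
    rw [_root_.heat, ← dirDeriv_dilAvg (hf.dirDeriv _)]
    exact (differentiable_dilAvg (hf.dirDeriv _) s x).hasFDerivAt.hasLineDerivAt _
  deriv_time s x := by
    refine (hasDerivAt_dilAvg b hf s x).congr_deriv ?_
    rw [sub_zero]
    unfold basisLaplacian
    rw [dilAvg_sum fun i => (hf.dirDeriv (b i)).dirDeriv (b i)]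

theorem hasDerivAt_sq_mul_rpow {u m : ℝ → ℝ} {u' m' t γ : ℝ} (hu : HasDerivAt u u' t)
    (hm : HasDerivAt m m' t) (hm0 : 0 < m t) :
    HasDerivAt (fun t => u t ^ 2 * m t ^ γ)
      (2 * u t * u' * m t ^ γ + γ * u t ^ 2 * m t ^ (γ - 1) * m') t := by
  refine ((hu.pow 2).mul (hm.rpow_const (p := γ) (Or.inl hm0.ne'))).congr_deriv ?_
  simp; ring

/-- The sink term created by the nonlinearity `u ^ 2 * m ^ γ`. -/
noncomputable def bellmanForm (γ u m a c : ℝ) : ℝ :=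
  2 * a ^ 2 * m ^ γ + 4 * γ * u * m ^ (γ - 1) * a * c + γ * (γ - 1) * u ^ 2 * m ^ (γ - 2) * c ^ 2

theorem sq_mul_rpow {u m : ℝ → E → ℝ} {u₁ u₂ m₁ m₂ : ι → ℝ → E → ℝ}
    (hu : IsHeatFlow b u u₁ u₂ fun _ _ => 0) (hm : IsHeatFlow b m m₁ m₂ fun _ _ => 0)
    (hm0 : ∀ s x, 0 < m s x) (γ : ℝ) :
    IsHeatFlow b (fun s x => u s x ^ 2 * m s x ^ γ)
      (fun i s x => 2 * u s x * u₁ i s x * m s x ^ γ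
        + γ * u s x ^ 2 * m s x ^ (γ - 1) * m₁ i s x)
      (fun i s x => bellmanForm γ (u s x) (m s x) (u₁ i s x) (m₁ i s x)
        + (2 * u s x * u₂ i s x * m s x ^ γ + γ * u s x ^ 2 * m s x ^ (γ - 1) * m₂ i s x))
      (fun s x => ∑ i, bellmanForm γ (u s x) (m s x) (u₁ i s x) (m₁ i s x)) := by
  have hr : ∀ δ : ℝ, Continuous fun p : ℝ × E => m p.1 p.2 ^ δ := fun δ =>
    hm.cont.rpow_const fun p => Or.inl (hm0 _ _).ne'
  have hu0 := hu.cont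
  have hu1 := hu.cont₁
  have hu2 := hu.cont₂
  have hm1 := hm.cont₁
  have hm2 := hm.cont₂
  have hB : ∀ i, Continuous fun p : ℝ × E =>
      bellmanForm γ (u p.1 p.2) (m p.1 p.2) (u₁ i p.1 p.2) (m₁ i p.1 p.2) := fun i => by
    unfold bellmanForm
    have h1 := hr γ
    have h2 := hr (γ - 1)
    have h3 := hr (γ - 2)
    have h4 := hu1 i
    have h5 := hm1 i
    fun_prop
  refine ⟨(hu0.pow 2).mul (hr γ), fun i => ?_, fun i => ?_, continuous_finsetSum _ fun i _ => hB i,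
    fun i s x => ?_, fun i s x => ?_, fun s x => ?_⟩
  · have h1 := hr γ
    have h2 := hr (γ - 1)
    have h4 := hu1 i
    have h5 := hm1 i
    fun_prop
  · have h1 := hr γ
    have h2 := hr (γ - 1)
    have h4 := hu2 i
    have h5 := hm2 i
    have h6 := hB i
    fun_prop
  · have := hasDerivAt_sq_mul_rpow (γ := γ) (hu.deriv₁ i s x) (hm.deriv₁ i s x) (by simpa using hm0 _ _)
    simp only [zero_smul, add_zero] at this
    exact this
  · have e1 : HasDerivAt (fun t => u s (x + t • b i)) (u₁ i s x) (0 : ℝ) := hu.deriv₁ i s x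
    have e2 : HasDerivAt (fun t => u₁ i s (x + t • b i)) (u₂ i s x) (0 : ℝ) := hu.deriv₂ i s x
    have e3 : HasDerivAt (fun t => m s (x + t • b i)) (m₁ i s x) (0 : ℝ) := hm.deriv₁ i s x
    have e4 : HasDerivAt (fun t => m₁ i s (x + t • b i)) (m₂ i s x) (0 : ℝ) := hm.deriv₂ i s x
    have hne : m s (x + (0 : ℝ) • b i) ≠ 0 := (hm0 _ _).ne'
    have h1 := ((e1.const_mul 2).mul e2).mul (e3.rpow_const (p := γ) (Or.inl hne))
    have h2 := (((e1.pow 2).const_mul γ).mul (e3.rpow_const (p := γ - 1) (Or.inl hne))).mul e4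
    refine HasDerivAt.congr_deriv (h1.add h2) ?_
    simp only [zero_smul, add_zero, bellmanForm]
    rw [show γ - 1 - 1 = γ - 2 by ring]
    simp
    ring
  · refine (hasDerivAt_sq_mul_rpow (γ := γ) (hu.deriv_time s x) (hm.deriv_time s x)
      (hm0 _ _)).congr_deriv ?_
    simp only [sub_zero, Finset.sum_add_distrib, ← Finset.mul_sum, ← Finset.sum_mul]
    ring

end IsHeatFlow

theorem integrable_cutoff_mul {χ : E → ℝ} (hχ : Continuous χ) (hχ' : HasCompactSupport χ)
    {G : ℝ → E → ℝ} (hG : Continuous fun p : ℝ × E => G p.1 p.2) (S : ℝ) :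
    Integrable (fun p : ℝ × E => χ p.2 * G p.1 p.2)
      ((volume.restrict (Ioc 0 S)).prod volume) := by
  have hc : Continuous fun p : ℝ × E => χ p.2 * G p.1 p.2 := by fun_prop
  have h1 : IntegrableOn (fun p : ℝ × E => χ p.2 * G p.1 p.2) (Icc 0 S ×ˢ tsupport χ)
      ((volume : Measure ℝ).prod (volume : Measure E)) :=
    hc.continuousOn.integrableOn_compact (isCompact_Icc.prod hχ')
  rw [← Measure.restrict_univ (μ := (volume : Measure E)), Measure.prod_restrict]
  refine IntegrableOn.of_forall_sdiff_eq_zero h1 (measurableSet_Ioc.prod MeasurableSet.univ) ?_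
  rintro ⟨s, x⟩ ⟨h2, h3⟩
  have : x ∉ tsupport χ := fun hx => h3 ⟨Ioc_subset_Icc_self h2.1, hx⟩
  simp [image_eq_zero_of_notMem_tsupport this]

theorem integrable_cutoff_mul_slice {χ : E → ℝ} (hχ : Continuous χ) (hχ' : HasCompactSupport χ)
    {G : ℝ → E → ℝ} (hG : Continuous fun p : ℝ × E => G p.1 p.2) (s : ℝ) :
    Integrable fun x => χ x * G s x :=
  (hχ.mul (hG.comp (Continuous.prodMk_right s))).integrable_of_hasCompactSupport hχ'.mul_right

theorem integral_cutoff_mul_lineDeriv {χ g g' : E → ℝ} (hχ : IsTest χ) (hg : Continuous g)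
    (hg' : Continuous g') (v : E) (h : ∀ x, HasLineDerivAt ℝ g (g' x) x v) :
    ∫ x, χ x * g' x = -∫ x, dirDeriv v χ x * g x := by
  refine integral_bilinear_hasLineDerivAt_right_eq_neg_left_of_integrable
    (B := ContinuousLinearMap.mul ℝ ℝ) (μ := (volume : Measure E)) (v := v) ?_ ?_ ?_
    (fun x _ => (hχ.differentiable x).hasFDerivAt.hasLineDerivAt v) (fun x _ => h x)
  · exact ((hχ.dirDeriv v).continuous.mul hg).integrable_of_hasCompactSupport
      (hχ.dirDeriv v).hasCompactSupport.mul_right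
  · exact (hχ.continuous.mul hg').integrable_of_hasCompactSupport hχ.hasCompactSupport.mul_right
  · exact (hχ.continuous.mul hg).integrable_of_hasCompactSupport hχ.hasCompactSupport.mul_right

/-- The total sink of a nonnegative flow is controlled by its initial mass and the cutoff error. -/
theorem IsHeatFlow.integral_sink_le {P Q : ℝ → E → ℝ} {P₁ P₂ : ι → ℝ → E → ℝ}
    (h : IsHeatFlow b P P₁ P₂ Q) (hP : ∀ s x, 0 ≤ P s x) {χ : E → ℝ} (hχ : IsTest χ)
    (hχ0 : ∀ x, 0 ≤ χ x) {S : ℝ} (hS : 0 ≤ S) :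
    ∫ s in Ioc 0 S, ∫ x, χ x * (s * Q s x) ≤ (∫ x, χ x * P 0 x)
      + ∫ s in Ioc 0 S, ∫ x, |basisLaplacian b χ x| * (s * P s x) := by
  have hL := hχ.basisLaplacian b
  have hsP : Continuous fun p : ℝ × E => p.1 * P p.1 p.2 := continuous_fst.mul h.cont
  have hsQ : Continuous fun p : ℝ × E => p.1 * Q p.1 p.2 := continuous_fst.mul h.contQ
  have hP2 : Continuous fun p : ℝ × E => ∑ i, P₂ i p.1 p.2 :=
    continuous_finsetSum _ fun i _ => h.cont₂ i
  have hlap : ∀ s, ∫ x, χ x * ∑ i, P₂ i s x = ∫ x, basisLaplacian b χ x * P s x := fun s => by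
    simp only [basisLaplacian, Finset.mul_sum, Finset.sum_mul]
    rw [integral_finsetSum _ fun i _ =>
        integrable_cutoff_mul_slice hχ.continuous hχ.hasCompactSupport (h.cont₂ i) s,
      integral_finsetSum _ fun i _ => integrable_cutoff_mul_slice
        ((hχ.dirDeriv (b i)).dirDeriv (b i)).continuous
        ((hχ.dirDeriv (b i)).dirDeriv (b i)).hasCompactSupport h.cont s]
    refine Finset.sum_congr rfl fun i _ => ?_
    have c0 : Continuous (P s) := h.cont.comp (Continuous.prodMk_right s)
    have c1 : Continuous (P₁ i s) := (h.cont₁ i).comp (Continuous.prodMk_right s)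
    have c2 : Continuous (P₂ i s) := (h.cont₂ i).comp (Continuous.prodMk_right s)
    rw [integral_cutoff_mul_lineDeriv hχ c1 c2 (b i) fun x => h.deriv₂ i s x,
      integral_cutoff_mul_lineDeriv (hχ.dirDeriv _) c0 c1 (b i) fun x => h.deriv₁ i s x, neg_neg]
  have hmain := integral_sub_integral_eq_of_hasDerivAt (F := fun s x => χ x * P s x)
    (F' := fun s x => χ x * (s * ((∑ i, P₂ i s x) - Q s x))) hS
    (fun s x => (h.deriv_time s x).const_mul _) ?_ ?_
    (integrable_cutoff_mul_slice hχ.continuous hχ.hasCompactSupport h.cont 0)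
    (integrable_cutoff_mul_slice hχ.continuous hχ.hasCompactSupport h.cont S)
  · have e : ∀ s, ∫ x, χ x * (s * ((∑ i, P₂ i s x) - Q s x))
        = (∫ x, basisLaplacian b χ x * (s * P s x)) - ∫ x, χ x * (s * Q s x) := fun s => by
      have e1 : ∀ x, χ x * (s * ((∑ i, P₂ i s x) - Q s x))
          = s * (χ x * ∑ i, P₂ i s x) - χ x * (s * Q s x) := fun x => by ring
      have e2 : ∀ x, basisLaplacian b χ x * (s * P s x) = s * (basisLaplacian b χ x * P s x) :=
        fun x => by ring
      simp only [e1, e2]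
      rw [integral_sub, integral_const_mul, hlap, integral_const_mul]
      · exact (integrable_cutoff_mul_slice hχ.continuous hχ.hasCompactSupport
          (G := fun s x => ∑ i, P₂ i s x) hP2 s).const_mul s
      · exact integrable_cutoff_mul_slice hχ.continuous hχ.hasCompactSupport (G := fun s x => s * Q s x) hsQ s
    have i1 := integrable_cutoff_mul hL.continuous hL.hasCompactSupport (G := fun s x => s * P s x) hsP S
    have i2 := integrable_cutoff_mul hχ.continuous hχ.hasCompactSupport (G := fun s x => s * Q s x) hsQ S
    have i3 := integrable_cutoff_mul hL.continuous.abs hL.hasCompactSupport.abs (G := fun s x => s * P s x) hsP S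
    simp only [e] at hmain
    rw [integral_sub i1.integral_prod_left i2.integral_prod_left] at hmain
    have hpos : 0 ≤ ∫ x, χ x * P S x := integral_nonneg fun x => mul_nonneg (hχ0 x) (hP _ _)
    have hle : ∫ s in Ioc 0 S, ∫ x, basisLaplacian b χ x * (s * P s x)
        ≤ ∫ s in Ioc 0 S, ∫ x, |basisLaplacian b χ x| * (s * P s x) := by
      refine setIntegral_mono_on i1.integral_prod_left i3.integral_prod_left measurableSet_Ioc
        fun s hs => ?_
      refine integral_mono (integrable_cutoff_mul_slice hL.continuous hL.hasCompactSupport (G := fun s x => s * P s x) hsP s)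
        (integrable_cutoff_mul_slice hL.continuous.abs hL.hasCompactSupport.abs (G := fun s x => s * P s x) hsP s) fun x => ?_
      exact mul_le_mul_of_nonneg_right (le_abs_self _) (mul_nonneg hs.1.le (hP _ _))
    linarith
  · have := h.contQ
    have := hχ.continuous
    fun_prop
  · exact integrable_cutoff_mul hχ.continuous hχ.hasCompactSupport
      (G := fun s x => s * ((∑ i, P₂ i s x) - Q s x)) (continuous_fst.mul (hP2.sub h.contQ)) S

end Bellman

section BellmanEstimate

variable {E : Type*} [NormedAddCommGroup E] [InnerProductSpace ℝ E] [FiniteDimensional ℝ E]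
  [MeasurableSpace E] [BorelSpace E] {ι : Type*} [Fintype ι] {b : OrthonormalBasis ι ℝ E}

namespace IsHeatFlow

/-- The loss constant in the lower bound for `bellmanForm`. -/
noncomputable def bellmanLoss (γ : ℝ) : ℝ := 4 * γ ^ 2 + |γ * (γ - 1)|

theorem bellmanLoss_nonneg (γ : ℝ) : 0 ≤ bellmanLoss γ := by unfold bellmanLoss; positivity

theorem le_bellmanForm {γ q u m a c : ℝ} (hm : 0 < m) (hu : u ^ 2 ≤ m ^ (q - γ)) :
    m ^ γ * a ^ 2 - bellmanLoss γ * (m ^ (q - 2) * c ^ 2) ≤ bellmanForm γ u m a c := by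
  have h1 : m ^ (γ - 1) = m * m ^ (γ - 2) := by
    rw [show γ - 1 = 1 + (γ - 2) by ring, Real.rpow_add hm, Real.rpow_one]
  have h2 : m ^ γ = m ^ 2 * m ^ (γ - 2) := by
    conv_lhs => rw [show γ = 2 + (γ - 2) by ring]
    rw [Real.rpow_add hm, Real.rpow_two]
  have hp : 0 < m ^ (γ - 2) := Real.rpow_pos_of_pos hm _
  have hr : u ^ 2 * m ^ (γ - 2) ≤ m ^ (q - 2) := by
    calc u ^ 2 * m ^ (γ - 2) ≤ m ^ (q - γ) * m ^ (γ - 2) := by gcongr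
      _ = m ^ (q - 2) := by rw [← Real.rpow_add hm]; ring_nf
  unfold bellmanForm
  rw [h1, h2]
  set p := m ^ (γ - 2)
  have h3 : 0 ≤ p * (m * a + 2 * γ * u * c) ^ 2 := by positivity
  have h4 : bellmanLoss γ * ((u ^ 2 * p) * c ^ 2) ≤ bellmanLoss γ * (m ^ (q - 2) * c ^ 2) := by
    have := bellmanLoss_nonneg γ
    gcongr
  have h5 : -(|γ * (γ - 1)| * (u ^ 2 * p * c ^ 2)) ≤ γ * (γ - 1) * (u ^ 2 * p * c ^ 2) := by
    rw [← neg_mul]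
    exact mul_le_mul_of_nonneg_right (neg_abs_le _) (by positivity)
  unfold bellmanLoss at *
  nlinarith

/-- The weight of the convex correction in the Bellman function. -/
noncomputable def bellmanWeight (γ q : ℝ) : ℝ := (bellmanLoss γ + bellmanLoss (-γ)) / (q * (q - 1))

theorem bellmanWeight_nonneg {q : ℝ} (hq : 1 < q) (γ : ℝ) : 0 ≤ bellmanWeight γ q := by
  have h1 := bellmanLoss_nonneg γ
  have h2 := bellmanLoss_nonneg (-γ)
  have : 0 < q - 1 := by linarith
  unfold bellmanWeight
  positivity

theorem two_mul_abs_le_bellmanForm {γ q u v m : ℝ} {a d c : ι → ℝ} (hq : 1 < q) (hm : 0 < m)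
    (hu : u ^ 2 ≤ m ^ (q - γ)) (hv : v ^ 2 ≤ m ^ (q + γ)) (j k : ι) :
    2 * |a j * d k| ≤ ((∑ i, bellmanForm γ u m (a i) (c i)) + ∑ i, bellmanForm (-γ) v m (d i) (c i))
      + bellmanWeight γ q * ∑ i, bellmanForm q 1 m 0 (c i) := by
  have hpos : 0 < m ^ γ := Real.rpow_pos_of_pos hm _
  have hsum : (∑ i, m ^ γ * a i ^ 2) + ∑ i, m ^ (-γ) * d i ^ 2
      ≤ ((∑ i, bellmanForm γ u m (a i) (c i)) + ∑ i, bellmanForm (-γ) v m (d i) (c i))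
      + bellmanWeight γ q * ∑ i, bellmanForm q 1 m 0 (c i) := by
    rw [Finset.mul_sum, ← Finset.sum_add_distrib, ← Finset.sum_add_distrib,
      ← Finset.sum_add_distrib]
    refine Finset.sum_le_sum fun i _ => ?_
    have h1 := le_bellmanForm (a := a i) (c := c i) hm hu
    have h2 := le_bellmanForm (γ := -γ) (q := q) (a := d i) (c := c i) hm (by simpa using hv)
    have h3 : bellmanWeight γ q * bellmanForm q 1 m 0 (c i)
        = (bellmanLoss γ + bellmanLoss (-γ)) * (m ^ (q - 2) * c i ^ 2) := by
      have : q * (q - 1) ≠ 0 := by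
        have : 0 < q - 1 := by linarith
        positivity
      have h4 : bellmanForm q 1 m 0 (c i) = q * (q - 1) * (m ^ (q - 2) * c i ^ 2) := by
        unfold bellmanForm; ring
      rw [h4, bellmanWeight, ← mul_assoc, div_mul_cancel₀ _ this]
    linarith
  refine le_trans ?_ hsum
  have h1 : m ^ γ * a j ^ 2 ≤ ∑ i, m ^ γ * a i ^ 2 :=
    Finset.single_le_sum (f := fun i => m ^ γ * a i ^ 2) (fun i _ => by positivity)
      (Finset.mem_univ j)
  have h2 : m ^ (-γ) * d k ^ 2 ≤ ∑ i, m ^ (-γ) * d i ^ 2 :=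
    Finset.single_le_sum (f := fun i => m ^ (-γ) * d i ^ 2) (fun i _ => by positivity)
      (Finset.mem_univ k)
  refine le_trans ?_ (add_le_add h1 h2)
  rw [Real.rpow_neg hm.le, abs_mul, ← sq_abs (a j), ← sq_abs (d k)]
  have h3 : 0 ≤ (m ^ γ * |a j| - |d k|) ^ 2 / m ^ γ := by positivity
  have h4 : (m ^ γ * |a j| - |d k|) ^ 2 / m ^ γ
      = m ^ γ * |a j| ^ 2 + (m ^ γ)⁻¹ * |d k| ^ 2 - 2 * (|a j| * |d k|) := by
    field_simp; ring
  linarith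

end IsHeatFlow

theorem integral_cutoff_mono {χ : E → ℝ} (hχ : Continuous χ) (hχ' : HasCompactSupport χ)
    (hχ0 : ∀ x, 0 ≤ χ x) {F G : ℝ → E → ℝ} (hF : Continuous fun p : ℝ × E => F p.1 p.2)
    (hG : Continuous fun p : ℝ × E => G p.1 p.2) (S : ℝ) (h : ∀ s > 0, ∀ x, F s x ≤ G s x) :
    ∫ s in Ioc 0 S, ∫ x, χ x * F s x ≤ ∫ s in Ioc 0 S, ∫ x, χ x * G s x := by
  refine setIntegral_mono_on (integrable_cutoff_mul hχ hχ' hF S).integral_prod_left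
    (integrable_cutoff_mul hχ hχ' hG S).integral_prod_left measurableSet_Ioc fun s hs => ?_
  exact integral_mono (integrable_cutoff_mul_slice hχ hχ' hF s)
    (integrable_cutoff_mul_slice hχ hχ' hG s) fun x => mul_le_mul_of_nonneg_left (h s hs.1 x) (hχ0 x)

open IsHeatFlow

variable {α β : ℝ} {f g h : E → ℝ}

/-- The Bellman function estimate, localized by a cutoff and regularized by `ε`. -/
theorem abs_integral_heat_dirDeriv_le_of_pos (hα : 0 < α) (hα1 : α ≤ 1) (hβ : 0 < β) (hβ1 : β ≤ 1)
    (hαβ : 1 < α + β) (hf : IsTest f) (hg : IsTest g) (hh : IsTest h) (hh0 : ∀ x, 0 ≤ h x)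
    (hfh : ∀ x, |f x| ≤ h x ^ α) (hgh : ∀ x, |g x| ≤ h x ^ β) {χ : E → ℝ} (hχ : IsTest χ)
    (hχ0 : ∀ x, 0 ≤ χ x) {S ε : ℝ} (hS : 0 ≤ S) (hε : 0 < ε) (j k : ι) :
    |∫ s in Ioc 0 S, ∫ x, χ x * (s * (heat (dirDeriv (b j) f) s x * heat (dirDeriv (b k) g) s x))|
      ≤ (2 + bellmanWeight (β - α) (α + β)) * ((∫ x, χ x * (heat h 0 x + ε) ^ (α + β))
        + ∫ s in Ioc 0 S, ∫ x, |basisLaplacian b χ x| * (s * (heat h s x + ε) ^ (α + β))) := by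
  obtain ⟨C, hC⟩ := hh.exists_bound
  set K := bellmanWeight (β - α) (α + β) with hK
  have hK0 : 0 ≤ K := bellmanWeight_nonneg hαβ _
  have hm := (IsHeatFlow.heat (b := b) hh).add (IsHeatFlow.const ε)
  simp only [add_zero] at hm
  have hH0 : ∀ s x, 0 ≤ heat h s x := dilAvg_nonneg hh0
  have hm0 : ∀ s x, 0 < heat h s x + ε := fun s x => add_pos_of_nonneg_of_pos (hH0 s x) hε
  have hpow : ∀ {r : ℝ} {φ : E → ℝ}, 0 < r → r ≤ 1 → IsTest φ → (∀ x, |φ x| ≤ h x ^ r) → ∀ s x,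
      heat φ s x ^ 2 ≤ (heat h s x + ε) ^ (2 * r) := by
    intro r φ hr hr1 hφ hφh s x
    have h1 : |heat φ s x| ≤ (heat h s x + ε) ^ r :=
      (abs_dilAvg_le_rpow hr hr1 hφ.continuous hh.continuous hC hh0 hφh s x).trans
        (Real.rpow_le_rpow (hH0 s x) (by linarith) hr.le)
    rw [← sq_abs, mul_comm, Real.rpow_mul (hm0 s x).le, Real.rpow_two]
    gcongr
  have hU := (IsHeatFlow.heat (b := b) hf).sq_mul_rpow hm hm0 (β - α)
  have hV := (IsHeatFlow.heat (b := b) hg).sq_mul_rpow hm hm0 (-(β - α))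
  have hM := ((IsHeatFlow.const (b := b) 1).sq_mul_rpow hm hm0 (α + β)).const_mul K
  obtain ⟨P, P₁, P₂, Q, hflow, hP0, hPle, hQ⟩ : ∃ P P₁ P₂ Q, IsHeatFlow b P P₁ P₂ Q ∧
      (∀ s x, 0 ≤ P s x) ∧ (∀ s x, P s x ≤ (2 + K) * (heat h s x + ε) ^ (α + β)) ∧
      ∀ s x, 2 * |heat (dirDeriv (b j) f) s x * heat (dirDeriv (b k) g) s x| ≤ Q s x := by
    refine ⟨_, _, _, _, (hU.add hV).add hM, fun s x => ?_, fun s x => ?_, fun s x => ?_⟩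
    · have := hm0 s x
      positivity
    · have e1 : heat f s x ^ 2 * (heat h s x + ε) ^ (β - α) ≤ (heat h s x + ε) ^ (α + β) := by
        refine (mul_le_mul_of_nonneg_right (hpow hα hα1 hf hfh s x)
          (Real.rpow_nonneg (hm0 s x).le _)).trans_eq ?_
        rw [← Real.rpow_add (hm0 s x)]; ring_nf
      have e2 : heat g s x ^ 2 * (heat h s x + ε) ^ (-(β - α)) ≤ (heat h s x + ε) ^ (α + β) := by
        refine (mul_le_mul_of_nonneg_right (hpow hβ hβ1 hg hgh s x)
          (Real.rpow_nonneg (hm0 s x).le _)).trans_eq ?_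
        rw [← Real.rpow_add (hm0 s x)]; ring_nf
      linarith
    · exact two_mul_abs_le_bellmanForm (γ := β - α) (a := fun i => heat (dirDeriv (b i) f) s x)
        (d := fun i => heat (dirDeriv (b i) g) s x)
        (c := fun i => heat (dirDeriv (b i) h) s x) hαβ (hm0 s x)
        ((hpow hα hα1 hf hfh s x).trans_eq (by ring_nf))
        ((hpow hβ hβ1 hg hgh s x).trans_eq (by ring_nf)) j k
  have key := hflow.integral_sink_le hP0 hχ hχ0 hS
  have hL := hχ.basisLaplacian b
  have cM : Continuous fun p : ℝ × E => (heat h p.1 p.2 + ε) ^ (α + β) :=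
    hm.cont.rpow_const fun p => Or.inl (hm0 _ _).ne'
  have cUV : Continuous fun p : ℝ × E =>
      p.1 * (heat (dirDeriv (b j) f) p.1 p.2 * heat (dirDeriv (b k) g) p.1 p.2) :=
    continuous_fst.mul ((hf.dirDeriv _).continuous_heat.mul (hg.dirDeriv _).continuous_heat)
  have h1 : (∫ x, χ x * P 0 x) ≤ (2 + K) * ∫ x, χ x * (heat h 0 x + ε) ^ (α + β) := by
    rw [← integral_const_mul]
    refine integral_mono
      (integrable_cutoff_mul_slice hχ.continuous hχ.hasCompactSupport hflow.cont 0)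
      ((integrable_cutoff_mul_slice hχ.continuous hχ.hasCompactSupport
        (G := fun s x => (heat h s x + ε) ^ (α + β)) cM 0).const_mul _) fun x => ?_
    simp only []
    rw [mul_left_comm (2 + K)]
    exact mul_le_mul_of_nonneg_left (hPle 0 x) (hχ0 x)
  have h2 := integral_cutoff_mono hL.continuous.abs hL.hasCompactSupport.abs
    (fun x => abs_nonneg _) (F := fun s x => s * P s x)
    (G := fun s x => (2 + K) * (s * (heat h s x + ε) ^ (α + β)))
    (continuous_fst.mul hflow.cont)
    (continuous_const.mul (continuous_fst.mul cM)) S fun s hs x => by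
      rw [mul_left_comm (2 + K)]
      exact mul_le_mul_of_nonneg_left (hPle s x) hs.le
  have h3 := integral_cutoff_mono hχ.continuous hχ.hasCompactSupport hχ0
    (F := fun s x => 2 * |s * (heat (dirDeriv (b j) f) s x * heat (dirDeriv (b k) g) s x)|)
    (G := fun s x => s * Q s x)
    (continuous_const.mul cUV.abs) (continuous_fst.mul hflow.contQ) S fun s hs x => by
      rw [abs_mul s, abs_of_pos hs, mul_left_comm]
      exact mul_le_mul_of_nonneg_left (hQ s x) hs.le
  have h4 : |∫ s in Ioc 0 S, ∫ x, χ x * (s * (heat (dirDeriv (b j) f) s x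
      * heat (dirDeriv (b k) g) s x))| ≤ ∫ s in Ioc 0 S, ∫ x, χ x *
        |s * (heat (dirDeriv (b j) f) s x * heat (dirDeriv (b k) g) s x)| := by
    refine (norm_integral_le_integral_norm fun s => ∫ x, χ x * (s * (heat (dirDeriv (b j) f) s x
      * heat (dirDeriv (b k) g) s x))).trans ?_
    refine setIntegral_mono_on (integrable_cutoff_mul hχ.continuous hχ.hasCompactSupport
      (G := fun s x => s * (heat (dirDeriv (b j) f) s x
      * heat (dirDeriv (b k) g) s x)) cUV S).integral_prod_left.norm
      (integrable_cutoff_mul hχ.continuous hχ.hasCompactSupport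
      (G := fun s x => |s * (heat (dirDeriv (b j) f) s x
      * heat (dirDeriv (b k) g) s x)|) cUV.abs S).integral_prod_left measurableSet_Ioc
      fun s _ => ?_
    refine (norm_integral_le_integral_norm _).trans_eq (integral_congr_ae (ae_of_all _ fun x => ?_))
    simp only [norm_mul, Real.norm_of_nonneg (hχ0 x), abs_mul, Real.norm_eq_abs]
  have m1 : ∀ (c : ℝ) (ψ : E → ℝ) (G : ℝ → E → ℝ), ∫ s in Ioc 0 S, ∫ x, ψ x * (c * G s x)
      = c * ∫ s in Ioc 0 S, ∫ x, ψ x * G s x := fun c ψ G => by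
    simp only [mul_left_comm _ c, integral_const_mul]
  rw [m1 _ _ fun s x => s * (heat h s x + ε) ^ (α + β)] at h2
  rw [m1 _ _ fun s x => |s * (heat (dirDeriv (b j) f) s x * heat (dirDeriv (b k) g) s x)|] at h3
  have h5 : 0 ≤ (2 + K) * ((∫ x, χ x * (heat h 0 x + ε) ^ (α + β))
      + ∫ s in Ioc 0 S, ∫ x, |basisLaplacian b χ x| * (s * (heat h s x + ε) ^ (α + β))) := by
    refine mul_nonneg (by linarith) (add_nonneg (integral_nonneg fun x => ?_)
      (setIntegral_nonneg measurableSet_Ioc fun s hs => integral_nonneg fun x => ?_))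
    · exact mul_nonneg (hχ0 x) (Real.rpow_nonneg (hm0 0 x).le _)
    · exact mul_nonneg (abs_nonneg _) (mul_nonneg hs.1.le (Real.rpow_nonneg (hm0 s x).le _))
  linarith

end BellmanEstimate

section BellmanLimit

variable {E : Type*} [NormedAddCommGroup E] [InnerProductSpace ℝ E] [FiniteDimensional ℝ E]
  [MeasurableSpace E] [BorelSpace E] {ι : Type*} [Fintype ι] {b : OrthonormalBasis ι ℝ E}

theorem add_rpow_le_two_rpow_mul {a c p : ℝ} (ha : 0 ≤ a) (hc : 0 ≤ c) (hp : 0 ≤ p) :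
    (a + c) ^ p ≤ 2 ^ p * (a ^ p + c ^ p) := by
  have ha' := Real.rpow_nonneg ha p
  have hc' := Real.rpow_nonneg hc p
  have h2 : (0 : ℝ) ≤ 2 ^ p := by positivity
  rcases le_total a c with h | h
  · calc (a + c) ^ p ≤ (2 * c) ^ p := Real.rpow_le_rpow (by positivity) (by linarith) hp
      _ = 2 ^ p * c ^ p := Real.mul_rpow (by norm_num) hc
      _ ≤ _ := mul_le_mul_of_nonneg_left (by linarith) h2
  · calc (a + c) ^ p ≤ (2 * a) ^ p := Real.rpow_le_rpow (by positivity) (by linarith) hp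
      _ = 2 ^ p * a ^ p := Real.mul_rpow (by norm_num) ha
      _ ≤ _ := mul_le_mul_of_nonneg_left (by linarith) h2

theorem dirDeriv_comp_smul (c : ℝ) (v : E) (f : E → ℝ) :
    dirDeriv v (fun x => f (c • x)) = fun x => c * dirDeriv v f (c • x) := by
  ext x
  simp [dirDeriv, fderiv_comp_smul]

theorem dirDeriv_const_mul (c : ℝ) (v : E) (f : E → ℝ) :
    dirDeriv v (fun x => c * f x) = fun x => c * dirDeriv v f x := by
  ext x
  have := congrFun (fderiv_const_smul_field (𝕜 := ℝ) (f := f) c) x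
  change fderiv ℝ (c • f) x v = c * fderiv ℝ f x v
  rw [this]
  rfl

theorem dirDeriv_dirDeriv_comp_smul (c : ℝ) (v w : E) (f : E → ℝ) :
    dirDeriv v (dirDeriv w fun x => f (c • x))
      = fun x => c ^ 2 * dirDeriv v (dirDeriv w f) (c • x) := by
  rw [dirDeriv_comp_smul, dirDeriv_const_mul, dirDeriv_comp_smul]
  ext x; ring

theorem basisLaplacian_comp_smul (c : ℝ) (f : E → ℝ) (x : E) :
    basisLaplacian b (fun x => f (c • x)) x = c ^ 2 * basisLaplacian b f (c • x) := by
  simp [basisLaplacian, dirDeriv_dirDeriv_comp_smul, Finset.mul_sum]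

theorem IsTest.comp_smul {f : E → ℝ} (hf : IsTest f) {c : ℝ} (hc : c ≠ 0) :
    IsTest fun x => f (c • x) where
  contDiff := hf.contDiff.comp (contDiff_const_smul c)
  hasCompactSupport := hf.hasCompactSupport.comp_smul hc



variable {α β : ℝ} {f g h : E → ℝ}

/-- The constant in the Bellman function estimate. -/
noncomputable def bellmanConst (α β : ℝ) : ℝ :=
  (2 + IsHeatFlow.bellmanWeight (β - α) (α + β)) * 2 ^ (α + β)

theorem abs_integral_heat_dirDeriv_le_cutoff (hα : 0 < α) (hα1 : α ≤ 1) (hβ : 0 < β) (hβ1 : β ≤ 1)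
    (hαβ : 1 < α + β) (hf : IsTest f) (hg : IsTest g) (hh : IsTest h) (hh0 : ∀ x, 0 ≤ h x)
    (hfh : ∀ x, |f x| ≤ h x ^ α) (hgh : ∀ x, |g x| ≤ h x ^ β) {χ : E → ℝ} (hχ : IsTest χ)
    (hχ0 : ∀ x, 0 ≤ χ x) {S : ℝ} (hS : 0 ≤ S) (j k : ι) :
    |∫ s in Ioc 0 S, ∫ x, χ x * (s * (heat (dirDeriv (b j) f) s x * heat (dirDeriv (b k) g) s x))|
      ≤ bellmanConst α β * ((∫ x, χ x * h x ^ (α + β))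
        + ∫ s in Ioc 0 S, ∫ x, |basisLaplacian b χ x| * (s * heat h s x ^ (α + β))) := by
  set q := α + β with hq
  have hq0 : 0 < q := by linarith
  have hK0 : 0 ≤ 2 + IsHeatFlow.bellmanWeight (β - α) q := by
    have := IsHeatFlow.bellmanWeight_nonneg hαβ (β - α); linarith
  have hL := hχ.basisLaplacian b
  have hH0 : ∀ s x, 0 ≤ heat h s x := dilAvg_nonneg hh0
  have c1 : Continuous fun p : ℝ × E => heat h p.1 p.2 ^ q :=
    hh.continuous_heat.rpow_const fun _ => Or.inr hq0.le
  have c2 : ∀ ε : ℝ, Continuous fun p : ℝ × E => (heat h p.1 p.2 + ε) ^ q := fun ε =>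
    (hh.continuous_heat.add continuous_const).rpow_const fun _ => Or.inr hq0.le
  have hsplit : ∀ ε > 0, ∀ s x, (heat h s x + ε) ^ q ≤ 2 ^ q * (heat h s x ^ q + ε ^ q) := by
    exact fun ε hε s x => add_rpow_le_two_rpow_mul (hH0 s x) hε.le hq0.le
  have hstep : ∀ ε > 0, |∫ s in Ioc 0 S, ∫ x, χ x * (s * (heat (dirDeriv (b j) f) s x
      * heat (dirDeriv (b k) g) s x))| ≤ bellmanConst α β * ((∫ x, χ x * h x ^ q)
        + ∫ s in Ioc 0 S, ∫ x, |basisLaplacian b χ x| * (s * heat h s x ^ q))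
      + ε ^ q * (bellmanConst α β * ((∫ x, χ x)
        + ∫ s in Ioc 0 S, ∫ x, |basisLaplacian b χ x| * s)) := by
    intro ε hε
    refine (abs_integral_heat_dirDeriv_le_of_pos hα hα1 hβ hβ1 hαβ hf hg hh hh0 hfh hgh hχ hχ0 hS
      hε j k).trans ?_
    have i1 : Integrable fun x => χ x * h x ^ q :=
      (hχ.continuous.mul (hh.continuous.rpow_const fun _ => Or.inr hq0.le)
        ).integrable_of_hasCompactSupport hχ.hasCompactSupport.mul_right
    have e1 : ∫ x, χ x * (heat h 0 x + ε) ^ q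
        ≤ 2 ^ q * ((∫ x, χ x * h x ^ q) + ε ^ q * ∫ x, χ x) := by
      rw [← integral_const_mul, ← integral_add, ← integral_const_mul]
      · refine integral_mono (integrable_cutoff_mul_slice hχ.continuous hχ.hasCompactSupport
          (G := fun s x => (heat h s x + ε) ^ q) (c2 ε) 0) ?_ fun x => ?_
        · exact (i1.add (hχ.integrable.const_mul _)).const_mul _
        · have := mul_le_mul_of_nonneg_left (hsplit ε hε 0 x) (hχ0 x)
          simp only [heat, dilAvg_zero] at this ⊢
          linarith
      · exact i1
      · exact hχ.integrable.const_mul _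
    have e2 : ∫ s in Ioc 0 S, ∫ x, |basisLaplacian b χ x| * (s * (heat h s x + ε) ^ q)
        ≤ 2 ^ q * ((∫ s in Ioc 0 S, ∫ x, |basisLaplacian b χ x| * (s * heat h s x ^ q))
          + ε ^ q * ∫ s in Ioc 0 S, ∫ x, |basisLaplacian b χ x| * s) := by
      have i2 := integrable_cutoff_mul hL.continuous.abs hL.hasCompactSupport.abs
        (G := fun s x => s * heat h s x ^ q) (continuous_fst.mul c1) S
      have i3 := integrable_cutoff_mul hL.continuous.abs hL.hasCompactSupport.abs
        (G := fun s x => s) continuous_fst S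
      have hm := integral_cutoff_mono hL.continuous.abs hL.hasCompactSupport.abs
        (fun x => abs_nonneg _) (F := fun s x => s * (heat h s x + ε) ^ q)
        (G := fun s x => 2 ^ q * (s * heat h s x ^ q + ε ^ q * s))
        (continuous_fst.mul (c2 ε)) (continuous_const.mul ((continuous_fst.mul c1).add
          (continuous_const.mul continuous_fst))) S fun s hs x =>
            (mul_le_mul_of_nonneg_left (hsplit ε hε s x) hs.le).trans_eq (by ring)
      refine hm.trans_eq ?_
      rw [← integral_const_mul, ← integral_add i2.integral_prod_left
        (i3.integral_prod_left.const_mul _), ← integral_const_mul]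
      refine integral_congr_ae (ae_of_all _ fun s => ?_)
      simp only []
      rw [← integral_const_mul, ← integral_add, ← integral_const_mul]
      · refine integral_congr_ae (ae_of_all _ fun x => ?_)
        simp only []
        ring
      · exact integrable_cutoff_mul_slice hL.continuous.abs hL.hasCompactSupport.abs
          (G := fun s x => s * heat h s x ^ q) (continuous_fst.mul c1) s
      · exact (integrable_cutoff_mul_slice hL.continuous.abs hL.hasCompactSupport.abs
          (G := fun s x => s) continuous_fst s).const_mul _
    refine (mul_le_mul_of_nonneg_left (add_le_add e1 e2) hK0).trans_eq ?_
    rw [bellmanConst]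
    ring
  have hlim : Tendsto (fun ε : ℝ => bellmanConst α β * ((∫ x, χ x * h x ^ q)
        + ∫ s in Ioc 0 S, ∫ x, |basisLaplacian b χ x| * (s * heat h s x ^ q))
      + ε ^ q * (bellmanConst α β * ((∫ x, χ x)
        + ∫ s in Ioc 0 S, ∫ x, |basisLaplacian b χ x| * s))) (𝓝[>] 0) (𝓝 (bellmanConst α β *
        ((∫ x, χ x * h x ^ q)
        + ∫ s in Ioc 0 S, ∫ x, |basisLaplacian b χ x| * (s * heat h s x ^ q)))) := by
    refine Tendsto.mono_left ?_ nhdsWithin_le_nhds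
    have h1 : Continuous fun ε : ℝ => ε ^ q := Real.continuous_rpow_const hq0.le
    have h2 := (((h1.tendsto 0).mul_const (bellmanConst α β * ((∫ x, χ x)
        + ∫ s in Ioc 0 S, ∫ x, |basisLaplacian b χ x| * s))).const_add
      (bellmanConst α β * ((∫ x, χ x * h x ^ q)
        + ∫ s in Ioc 0 S, ∫ x, |basisLaplacian b χ x| * (s * heat h s x ^ q))))
    rwa [Real.zero_rpow hq0.ne', zero_mul, add_zero] at h2
  exact ge_of_tendsto hlim (eventually_mem_nhdsWithin.mono fun ε hε => hstep ε hε)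

/-- The Bellman function estimate for the whole space. -/
theorem abs_integral_heat_dirDeriv_le (hα : 0 < α) (hα1 : α ≤ 1) (hβ : 0 < β) (hβ1 : β ≤ 1)
    (hαβ : 1 < α + β) (hf : IsTest f) (hg : IsTest g) (hh : IsTest h) (hh0 : ∀ x, 0 ≤ h x)
    (hfh : ∀ x, |f x| ≤ h x ^ α) (hgh : ∀ x, |g x| ≤ h x ^ β) {S : ℝ} (hS : 0 < S) (j k : ι) :
    |∫ s in Ioc 0 S, s * ∫ x, heat (dirDeriv (b j) f) s x * heat (dirDeriv (b k) g) s x|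
      ≤ bellmanConst α β * ∫ x, h x ^ (α + β) := by
  set q := α + β with hq
  have hq0 : 0 < q := by linarith
  have hK0 : 0 ≤ bellmanConst α β := by
    have := IsHeatFlow.bellmanWeight_nonneg hαβ (β - α)
    unfold bellmanConst; positivity
  set χ₀ : ContDiffBump (0 : E) := ⟨1, 2, one_pos, one_lt_two⟩
  have hχ₀ : IsTest χ₀ := ⟨χ₀.contDiff, χ₀.hasCompactSupport⟩
  obtain ⟨C, hC⟩ := (hχ₀.basisLaplacian b).exists_bound
  obtain ⟨D, hD⟩ := hh.exists_bound
  have hC0 : 0 ≤ C := (norm_nonneg _).trans (hC 0)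
  have hD0 : 0 ≤ D := (norm_nonneg _).trans (hD 0)
  set c : ℕ → ℝ := fun n => 1 / ((n : ℝ) + 1) with hc
  have hc0 : ∀ n, 0 < c n := fun n => Nat.one_div_pos_of_nat
  have hclim : Tendsto c atTop (𝓝 0) := tendsto_one_div_add_atTop_nhds_zero_nat
  set χ : ℕ → E → ℝ := fun n x => χ₀ (c n • x) with hχdef
  have hχ : ∀ n, IsTest (χ n) := fun n => hχ₀.comp_smul (hc0 n).ne'
  have hχ0 : ∀ n x, 0 ≤ χ n x := fun n x => χ₀.nonneg
  have hχ1 : ∀ n x, χ n x ≤ 1 := fun n x => χ₀.le_one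
  have hχlim : ∀ x, Tendsto (fun n => χ n x) atTop (𝓝 1) := by
    intro x
    have h1 : Tendsto (fun n => χ₀ (c n • x)) atTop (𝓝 (χ₀ ((0 : ℝ) • x))) :=
      (hχ₀.continuous.tendsto _).comp (hclim.smul_const x)
    rwa [zero_smul, χ₀.one_of_mem_closedBall (by simpa using χ₀.rIn_pos.le)] at h1
  have hL : ∀ n x, |basisLaplacian b (χ n) x| ≤ c n ^ 2 * C := by
    intro n x
    rw [hχdef, basisLaplacian_comp_smul, abs_mul, abs_of_nonneg (sq_nonneg _)]
    exact mul_le_mul_of_nonneg_left (hC _) (sq_nonneg _)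
  have hH0 : ∀ s x, 0 ≤ heat h s x := dilAvg_nonneg hh0
  have hHD : ∀ s x, heat h s x ≤ D := fun s x => (le_abs_self _).trans (abs_dilAvg_le hD s x)
  have hpow : ∀ y, 0 ≤ y → y ≤ D → y ^ q ≤ D ^ (q - 1) * y := by
    intro y hy hyD
    rcases hy.eq_or_lt with rfl | hy
    · simp [Real.zero_rpow hq0.ne']
    · have : y ^ q = y ^ (q - 1) * y := by
        rw [← Real.rpow_add_one hy.ne']; ring_nf
      rw [this]
      exact mul_le_mul_of_nonneg_right (Real.rpow_le_rpow hy.le hyD (by linarith)) hy.le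
  have hintg : Integrable fun x => h x ^ q := by
    refine (hh.continuous.rpow_const fun _ => Or.inr hq0.le).integrable_of_hasCompactSupport ?_
    exact hh.hasCompactSupport.comp_left (g := fun y : ℝ => y ^ q) (Real.zero_rpow hq0.ne')
  have hI0 : 0 ≤ ∫ x, h x := integral_nonneg hh0
  have hIh : ∀ s, ∫ x, heat h s x ≤ ∫ x, h x := by
    intro s
    have := integral_abs_dilAvg_le (ν := gaussMeasure E) hh s
    simpa only [abs_of_nonneg (hH0 s _), abs_of_nonneg (hh0 _)] using this
  have hb1 : ∀ n, ∫ x, χ n x * h x ^ q ≤ ∫ x, h x ^ q := by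
    intro n
    refine integral_mono_of_nonneg (ae_of_all _ fun x => ?_) hintg (ae_of_all _ fun x => ?_)
    · exact mul_nonneg (hχ0 n x) (Real.rpow_nonneg (hh0 x) _)
    · exact mul_le_of_le_one_left (Real.rpow_nonneg (hh0 x) _) (hχ1 n x)
  have hb2 : ∀ n, ∫ s in Ioc 0 S, ∫ x, |basisLaplacian b (χ n) x| * (s * heat h s x ^ q)
      ≤ c n ^ 2 * (C * S * D ^ (q - 1) * (∫ x, h x) * S) := by
    intro n
    have key : ∀ s ∈ Ioc 0 S, ‖∫ x, |basisLaplacian b (χ n) x| * (s * heat h s x ^ q)‖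
        ≤ c n ^ 2 * C * S * D ^ (q - 1) * ∫ x, h x := by
      intro s hs
      have h0 : ∀ x, 0 ≤ |basisLaplacian b (χ n) x| * (s * heat h s x ^ q) := fun x =>
        mul_nonneg (abs_nonneg _) (mul_nonneg hs.1.le (Real.rpow_nonneg (hH0 s x) _))
      rw [Real.norm_of_nonneg (integral_nonneg h0)]
      calc ∫ x, |basisLaplacian b (χ n) x| * (s * heat h s x ^ q)
          ≤ ∫ x, c n ^ 2 * C * S * D ^ (q - 1) * heat h s x := by
            refine integral_mono_of_nonneg (ae_of_all _ h0)
              ((integrable_dilAvg hh s).const_mul _) (ae_of_all _ fun x => ?_)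
            have h1 : s * heat h s x ^ q ≤ S * (D ^ (q - 1) * heat h s x) :=
              mul_le_mul hs.2 (hpow _ (hH0 s x) (hHD s x)) (Real.rpow_nonneg (hH0 s x) _) hS.le
            have h2 := mul_le_mul (hL n x) h1
              (mul_nonneg hs.1.le (Real.rpow_nonneg (hH0 s x) _)) (by positivity)
            refine h2.trans_eq (by ring)
        _ = c n ^ 2 * C * S * D ^ (q - 1) * ∫ x, heat h s x := integral_const_mul _ _
        _ ≤ _ := mul_le_mul_of_nonneg_left (hIh s) (by positivity)
    have := norm_setIntegral_le_of_norm_le_const (μ := volume) measure_Ioc_lt_top key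
    rw [Measure.real, Real.volume_Ioc, sub_zero, ENNReal.toReal_ofReal hS.le] at this
    refine ((le_abs_self _).trans this).trans_eq (by ring)
  have hΦ := integrable_prod_heat_mul_heat (hf.dirDeriv (b j)) (hg.dirDeriv (b k)) S
  set Φ : ℝ × E → ℝ := fun p =>
    p.1 * (heat (dirDeriv (b j) f) p.1 p.2 * heat (dirDeriv (b k) g) p.1 p.2) with hΦdef
  have hΦn : ∀ n, Integrable (fun p : ℝ × E => χ n p.2 * Φ p)
      ((volume.restrict (Ioc 0 S)).prod volume) := by
    intro n
    refine hΦ.bdd_mul (c := 1) ((hχ n).continuous.comp continuous_snd).aestronglyMeasurable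
      (ae_of_all _ fun p => ?_)
    rw [Real.norm_of_nonneg (hχ0 n _)]
    exact hχ1 n _
  have hlim : Tendsto (fun n => ∫ p : ℝ × E, χ n p.2 * Φ p
      ∂((volume.restrict (Ioc 0 S)).prod volume)) atTop
      (𝓝 (∫ p, Φ p ∂((volume.restrict (Ioc 0 S)).prod volume))) := by
    refine tendsto_integral_of_dominated_convergence (fun p => ‖Φ p‖)
      (fun n => (hΦn n).aestronglyMeasurable) hΦ.norm (fun n => ae_of_all _ fun p => ?_)
      (ae_of_all _ fun p => ?_)
    · rw [norm_mul, Real.norm_of_nonneg (hχ0 n _)]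
      exact mul_le_of_le_one_left (norm_nonneg _) (hχ1 n _)
    · simpa using (hχlim p.2).mul_const (Φ p)
  have hrhs : Tendsto (fun n => bellmanConst α β * ((∫ x, h x ^ q)
      + c n ^ 2 * (C * S * D ^ (q - 1) * (∫ x, h x) * S))) atTop
      (𝓝 (bellmanConst α β * ∫ x, h x ^ q)) := by
    have := (((hclim.pow 2).mul_const (C * S * D ^ (q - 1) * (∫ x, h x) * S)).const_add
      (∫ x, h x ^ q)).const_mul (bellmanConst α β)
    simpa using this
  have hmain : ∀ n, |∫ p : ℝ × E, χ n p.2 * Φ p ∂((volume.restrict (Ioc 0 S)).prod volume)|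
      ≤ bellmanConst α β * ((∫ x, h x ^ q)
      + c n ^ 2 * (C * S * D ^ (q - 1) * (∫ x, h x) * S)) := by
    intro n
    rw [integral_prod _ (hΦn n)]
    exact (abs_integral_heat_dirDeriv_le_cutoff hα hα1 hβ hβ1 hαβ hf hg hh hh0 hfh hgh (hχ n)
      (hχ0 n) hS.le j k).trans (mul_le_mul_of_nonneg_left (add_le_add (hb1 n) (hb2 n)) hK0)
  have hfin := le_of_tendsto_of_tendsto' hlim.abs hrhs hmain
  rw [integral_prod _ hΦ] at hfin
  simpa only [hΦdef, integral_const_mul] using hfin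

/-- The bilinear estimate for second derivatives of test functions. -/
theorem abs_integral_dirDeriv_dirDeriv_mul_le {u : E → ℝ} (hα : 0 < α) (hα1 : α ≤ 1) (hβ : 0 < β)
    (hβ1 : β ≤ 1) (hαβ : 1 < α + β) (hu : IsTest u) (hg : IsTest g) (hh : IsTest h)
    (hh0 : ∀ x, 0 ≤ h x) (hfh : ∀ x, |basisLaplacian b u x| ≤ h x ^ α)
    (hgh : ∀ x, |g x| ≤ h x ^ β) (j k : ι) :
    |∫ x, dirDeriv (b k) (dirDeriv (b j) u) x * g x|
      ≤ 2 * (bellmanConst α β * ∫ x, h x ^ (α + β)) :=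
  abs_integral_dirDeriv_mul_le b hu hg (b k) (b j) fun _ hS =>
    abs_integral_heat_dirDeriv_le hα hα1 hβ hβ1 hαβ (hu.basisLaplacian b) hg hh hh0 hfh hgh hS j k

end BellmanLimit

section Mollification

open scoped Pointwise

variable {E : Type*} [NormedAddCommGroup E] [InnerProductSpace ℝ E] [FiniteDimensional ℝ E]
  [MeasurableSpace E] [BorelSpace E] {ι : Type*} [Fintype ι] {b : OrthonormalBasis ι ℝ E}

/-- Mollification by a normed bump function. -/
noncomputable def mollify (φ : ContDiffBump (0 : E)) (f : E → ℝ) : E → ℝ :=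
  convolution (φ.normed volume) f (ContinuousLinearMap.lsmul ℝ ℝ) volume

/-- The probability measure whose density is a normed bump function. -/
noncomputable def bumpMeasure (φ : ContDiffBump (0 : E)) : Measure E :=
  volume.withDensity fun t => ENNReal.ofReal (φ.normed volume t)

instance (φ : ContDiffBump (0 : E)) : IsProbabilityMeasure (bumpMeasure φ) := by
  refine ⟨?_⟩
  rw [bumpMeasure, withDensity_apply _ MeasurableSet.univ, setLIntegral_univ,
    ← ofReal_integral_eq_lintegral_ofReal φ.integrable_normed (ae_of_all _ φ.nonneg_normed),
    φ.integral_normed, ENNReal.ofReal_one]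

variable {φ : ContDiffBump (0 : E)} {f g h : E → ℝ}

theorem mollify_eq_dilAvg : mollify φ f = dilAvg (bumpMeasure φ) f (-1) := by
  ext x
  rw [mollify, convolution_def, dilAvg, bumpMeasure,
    integral_withDensity_eq_integral_toReal_smul
      φ.continuous_normed.measurable.ennreal_ofReal (ae_of_all _ fun _ => ENNReal.ofReal_lt_top)]
  refine integral_congr_ae (ae_of_all _ fun y => ?_)
  simp [ENNReal.toReal_ofReal (φ.nonneg_normed y), sub_eq_add_neg]

theorem isTest_mollify (hf : Continuous f) (hf' : HasCompactSupport f) : IsTest (mollify φ f) where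
  contDiff := φ.hasCompactSupport_normed.contDiff_convolution_left _ φ.contDiff_normed
    hf.locallyIntegrable
  hasCompactSupport := φ.hasCompactSupport_normed.convolution _ hf'

theorem dirDeriv_mollify (hf : ContDiff ℝ 1 f) (hf' : HasCompactSupport f) (v : E) :
    dirDeriv v (mollify φ f) = mollify φ (dirDeriv v f) := by
  ext x
  have hl : LocallyIntegrable (φ.normed volume) volume := φ.continuous_normed.locallyIntegrable
  rw [dirDeriv, mollify, (hf'.hasFDerivAt_convolution_right _ hl hf x).fderiv,
    convolution_precompR_apply _ hl (hf'.fderiv ℝ) (hf.continuous_fderiv (by simp))]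
  rfl

theorem abs_mollify_le_rpow {α : ℝ} (hα : 0 < α) (hα1 : α ≤ 1) (hf : Continuous f)
    (hh : Continuous h) (hh' : HasCompactSupport h) (hh0 : ∀ x, 0 ≤ h x)
    (hfh : ∀ x, |f x| ≤ h x ^ α) (x : E) : |mollify φ f x| ≤ mollify φ h x ^ α := by
  obtain ⟨C, hC⟩ := hh'.exists_bound_of_continuous hh
  simp only [mollify_eq_dilAvg]
  exact abs_dilAvg_le_rpow hα hα1 hf hh hC hh0 hfh _ x

theorem mollify_sum {F : ι → E → ℝ} (hF : ∀ i, Continuous (F i))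
    (hF' : ∀ i, HasCompactSupport (F i)) (x : E) :
    mollify φ (fun x => ∑ i, F i x) x = ∑ i, mollify φ (F i) x := by
  simp only [mollify_eq_dilAvg, dilAvg]
  refine integral_finsetSum _ fun i _ => ?_
  obtain ⟨C, hC⟩ := (hF' i).exists_bound_of_continuous (hF i)
  exact integrable_comp_dil (hF i) hC _ x

theorem mollify_eq_zero_of_notMem (hφ : φ.rOut ≤ 1) {x : E}
    (hx : x ∉ closedBall (0 : E) 1 + tsupport f) : mollify φ f x = 0 := by
  by_contra hne
  obtain ⟨y, hy, z, hz, rfl⟩ := support_convolution_subset _ hne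
  refine hx ?_
  refine ⟨y, ?_, z, subset_closure hz, rfl⟩
  rw [φ.support_normed_eq] at hy
  exact closedBall_subset_closedBall hφ (ball_subset_closedBall hy)

theorem tendsto_integral_of_isCompact {F : ℕ → E → ℝ} {G : E → ℝ} {K : Set E} {C : ℝ}
    (hF : ∀ n, Continuous (F n)) (hK : IsCompact K) (hFK : ∀ n, ∀ x ∉ K, F n x = 0)
    (hC : ∀ n x, |F n x| ≤ C) (hlim : ∀ x, Tendsto (fun n => F n x) atTop (𝓝 (G x))) :
    Tendsto (fun n => ∫ x, F n x) atTop (𝓝 (∫ x, G x)) := by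
  refine tendsto_integral_of_dominated_convergence (K.indicator fun _ => C)
    (fun n => (hF n).aestronglyMeasurable) ?_ (fun n => ae_of_all _ fun x => ?_)
    (ae_of_all _ hlim)
  · rw [integrable_indicator_iff hK.measurableSet]
    exact integrableOn_const hK.measure_lt_top.ne
  · by_cases hx : x ∈ K
    · rw [indicator_of_mem hx]; exact hC n x
    · rw [hFK n x hx, indicator_of_notMem hx, norm_zero]

/-- A sequence of bump functions shrinking to the origin. -/
noncomputable def shrinkingBump (E : Type*) [NormedAddCommGroup E] [InnerProductSpace ℝ E]
    (n : ℕ) : ContDiffBump (0 : E) where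
  rIn := 1 / ((n : ℝ) + 1) / 2
  rOut := 1 / ((n : ℝ) + 1)
  rIn_pos := by positivity
  rIn_lt_rOut := half_lt_self (by positivity)

theorem shrinkingBump_rOut_le (n : ℕ) : (shrinkingBump E n).rOut ≤ 1 := by
  rw [shrinkingBump]
  simp only []
  rw [div_le_one (by positivity)]
  linarith [(Nat.cast_nonneg n : (0 : ℝ) ≤ n)]

theorem tendsto_mollify (hf : Continuous f) (x : E) :
    Tendsto (fun n => mollify (shrinkingBump E n) f x) atTop (𝓝 (f x)) :=
  ContDiffBump.convolution_tendsto_right_of_continuous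
    (tendsto_one_div_add_atTop_nhds_zero_nat (𝕜 := ℝ)) hf x

theorem abs_mollify_le {C : ℝ} (hC : ∀ x, ‖f x‖ ≤ C) (x : E) : |mollify φ f x| ≤ C := by
  rw [mollify_eq_dilAvg]; exact abs_dilAvg_le hC _ x

theorem continuous_dirDeriv (hf : ContDiff ℝ 1 f) (v : E) : Continuous (dirDeriv v f) :=
  (hf.continuous_fderiv (by simp)).clm_apply continuous_const

theorem contDiff_dirDeriv (hf : ContDiff ℝ 2 f) (v : E) : ContDiff ℝ 1 (dirDeriv v f) :=
  (hf.fderiv_right (m := 1) (by norm_num)).clm_apply contDiff_const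

theorem hasCompactSupport_dirDeriv (hf : HasCompactSupport f) (v : E) :
    HasCompactSupport (dirDeriv v f) := hf.fderiv_apply ℝ v

theorem hasCompactSupport_basisLaplacian (hf : HasCompactSupport f) :
    HasCompactSupport (basisLaplacian b f) := by
  refine HasCompactSupport.intro hf fun x hx => ?_
  refine Finset.sum_eq_zero fun i _ => ?_
  refine image_eq_zero_of_notMem_tsupport fun h => hx ?_
  exact (tsupport_fderiv_apply_subset ℝ _).trans (tsupport_fderiv_apply_subset ℝ _) h

theorem continuous_basisLaplacian (hf : ContDiff ℝ 2 f) : Continuous (basisLaplacian b f) :=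
  continuous_finsetSum _ fun _ _ => continuous_dirDeriv (contDiff_dirDeriv hf _) _

theorem basisLaplacian_mollify (hf : ContDiff ℝ 2 f) (hf' : HasCompactSupport f) :
    basisLaplacian b (mollify φ f) = mollify φ (basisLaplacian b f) := by
  ext x
  have hL : basisLaplacian b f = fun x => ∑ i, dirDeriv (b i) (dirDeriv (b i) f) x := rfl
  rw [hL, basisLaplacian, mollify_sum (F := fun i => dirDeriv (b i) (dirDeriv (b i) f))
    (fun i => continuous_dirDeriv (contDiff_dirDeriv hf _) _)
    (fun i => hasCompactSupport_dirDeriv (hasCompactSupport_dirDeriv hf' _) _)]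
  refine Finset.sum_congr rfl fun i _ => ?_
  rw [dirDeriv_mollify (hf.of_le (by norm_num)) hf',
    dirDeriv_mollify (contDiff_dirDeriv hf _) (hasCompactSupport_dirDeriv hf' _)]

variable {α β : ℝ}

/-- The bilinear estimate for second derivatives of compactly supported `C²` functions. -/
theorem abs_integral_dirDeriv_dirDeriv_mul_le_of_contDiff {u : E → ℝ} (hα : 0 < α) (hα1 : α ≤ 1)
    (hβ : 0 < β) (hβ1 : β ≤ 1) (hαβ : 1 < α + β) (hu : ContDiff ℝ 2 u) (hu' : HasCompactSupport u)
    (hg : Continuous g) (hg' : HasCompactSupport g) (hh : Continuous h) (hh' : HasCompactSupport h)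
    (hh0 : ∀ x, 0 ≤ h x) (hfh : ∀ x, |basisLaplacian b u x| ≤ h x ^ α)
    (hgh : ∀ x, |g x| ≤ h x ^ β) (j k : ι) :
    |∫ x, dirDeriv (b k) (dirDeriv (b j) u) x * g x|
      ≤ 2 * (bellmanConst α β * ∫ x, h x ^ (α + β)) := by
  set w := dirDeriv (b k) (dirDeriv (b j) u) with hw
  have hwc : Continuous w := continuous_dirDeriv (contDiff_dirDeriv hu _) _
  have hws : HasCompactSupport w :=
    hasCompactSupport_dirDeriv (hasCompactSupport_dirDeriv hu' _) _
  have hq0 : 0 < α + β := by linarith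
  have hstep : ∀ n, |∫ x, mollify (shrinkingBump E n) w x * mollify (shrinkingBump E n) g x|
      ≤ 2 * (bellmanConst α β * ∫ x, mollify (shrinkingBump E n) h x ^ (α + β)) := by
    intro n
    rw [hw, ← dirDeriv_mollify (contDiff_dirDeriv hu _) (hasCompactSupport_dirDeriv hu' _),
      ← dirDeriv_mollify (hu.of_le (by norm_num)) hu']
    refine abs_integral_dirDeriv_dirDeriv_mul_le hα hα1 hβ hβ1 hαβ
      (isTest_mollify hu.continuous hu') (isTest_mollify hg hg') (isTest_mollify hh hh')
      (fun x => ?_) (fun x => ?_) (abs_mollify_le_rpow hβ hβ1 hg hh hh' hh0 hgh) j k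
    · rw [mollify_eq_dilAvg]; exact dilAvg_nonneg hh0 _ _
    · rw [basisLaplacian_mollify hu hu']
      exact abs_mollify_le_rpow hα hα1 (continuous_basisLaplacian hu) hh hh' hh0 hfh x
  obtain ⟨Cw, hCw⟩ := hws.exists_bound_of_continuous hwc
  obtain ⟨Cg, hCg⟩ := hg'.exists_bound_of_continuous hg
  obtain ⟨Ch, hCh⟩ := hh'.exists_bound_of_continuous hh
  have l1 : Tendsto (fun n => ∫ x, mollify (shrinkingBump E n) w x
      * mollify (shrinkingBump E n) g x) atTop (𝓝 (∫ x, w x * g x)) := by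
    refine tendsto_integral_of_isCompact (K := closedBall (0 : E) 1 + tsupport w) (C := Cw * Cg)
      (fun n => (isTest_mollify hwc hws).continuous.mul (isTest_mollify hg hg').continuous)
      ((isCompact_closedBall _ _).add hws) (fun n x hx => ?_) (fun n x => ?_)
      fun x => (tendsto_mollify hwc x).mul (tendsto_mollify hg x)
    · rw [mollify_eq_zero_of_notMem (shrinkingBump_rOut_le n) hx, zero_mul]
    · rw [abs_mul]
      exact mul_le_mul (abs_mollify_le hCw x) (abs_mollify_le hCg x) (abs_nonneg _)
        ((norm_nonneg _).trans (hCw 0))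
  have l2 : Tendsto (fun n => ∫ x, mollify (shrinkingBump E n) h x ^ (α + β)) atTop
      (𝓝 (∫ x, h x ^ (α + β))) := by
    refine tendsto_integral_of_isCompact (K := closedBall (0 : E) 1 + tsupport h)
      (C := Ch ^ (α + β))
      (fun n => (isTest_mollify hh hh').continuous.rpow_const fun _ => Or.inr hq0.le)
      ((isCompact_closedBall _ _).add hh') (fun n x hx => ?_) (fun n x => ?_)
      fun x => (tendsto_mollify hh x).rpow_const (Or.inr hq0.le)
    · rw [mollify_eq_zero_of_notMem (shrinkingBump_rOut_le n) hx, Real.zero_rpow hq0.ne']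
    · exact (Real.abs_rpow_le_abs_rpow _ _).trans
        (Real.rpow_le_rpow (abs_nonneg _) (abs_mollify_le hCh x) hq0.le)
  exact le_of_tendsto_of_tendsto' l1.abs ((l2.const_mul _).const_mul _) hstep

/-- The odd power `|t| ^ (p - 2) * t`. -/
noncomputable def dualPower (p t : ℝ) : ℝ := max t 0 ^ (p - 1) - max (-t) 0 ^ (p - 1)

theorem continuous_dualPower {p : ℝ} (hp : 1 < p) : Continuous (dualPower p) :=
  ((continuous_id.max continuous_const).rpow_const fun _ => Or.inr (by linarith)).sub
    ((continuous_neg.max continuous_const).rpow_const fun _ => Or.inr (by linarith))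

theorem dualPower_zero (p : ℝ) : dualPower p 0 = 0 := by simp [dualPower]

theorem abs_dualPower {p : ℝ} (hp : 1 < p) (t : ℝ) : |dualPower p t| = |t| ^ (p - 1) := by
  have h0 : (0 : ℝ) ^ (p - 1) = 0 := Real.zero_rpow (by linarith)
  rcases le_total 0 t with h | h
  · rw [dualPower, max_eq_left h, max_eq_right (by linarith), h0, sub_zero, abs_of_nonneg h,
      abs_of_nonneg (Real.rpow_nonneg h _)]
  · rw [dualPower, max_eq_right h, max_eq_left (by linarith), h0, zero_sub, abs_neg,
      abs_of_nonpos h, abs_of_nonneg (Real.rpow_nonneg (by linarith) _)]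

theorem mul_dualPower {p : ℝ} (hp : 1 < p) (t : ℝ) : t * dualPower p t = |t| ^ p := by
  have h0 : (0 : ℝ) ^ (p - 1) = 0 := Real.zero_rpow (by linarith)
  have key : ∀ s : ℝ, 0 ≤ s → s * s ^ (p - 1) = s ^ p := by
    intro s hs
    rcases hs.eq_or_lt with rfl | hs
    · simp [Real.zero_rpow (by linarith : p ≠ 0)]
    · rw [mul_comm, ← Real.rpow_add_one hs.ne', sub_add_cancel]
  rcases le_total 0 t with h | h
  · rw [dualPower, max_eq_left h, max_eq_right (by linarith), h0, sub_zero, abs_of_nonneg h,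
      key t h]
  · rw [dualPower, max_eq_right h, max_eq_left (by linarith), h0, zero_sub, abs_of_nonpos h,
      ← key (-t) (by linarith)]
    ring

/-- The Calderón–Zygmund inequality for compactly supported `C²` functions. -/
theorem exists_integral_rpow_dirDeriv_dirDeriv_le (b : OrthonormalBasis ι ℝ E) {p : ℝ}
    (hp : 1 < p) : ∃ C > 0, ∀ u : E → ℝ, ContDiff ℝ 2 u → HasCompactSupport u → ∀ j k,
      ∫ x, |dirDeriv (b k) (dirDeriv (b j) u) x| ^ p ≤ C * ∫ x, |basisLaplacian b u x| ^ p := by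
  have hp0 : 0 < p := by linarith
  have hp1 : 0 < p - 1 := by linarith
  set r := p / (p - 1) with hr
  have hr0 : 0 < r := by positivity
  have hr1 : 1 < r := by rw [hr, lt_div_iff₀ hp1]; linarith
  have hrp : (p - 1) * r = p := by rw [hr]; field_simp
  set q := min p r with hq
  have hq1 : 1 < q := lt_min hp hr1
  have hq0 : 0 < q := by linarith
  set α := q / p with hα
  set β := q / r with hβ
  have hα0 : 0 < α := by positivity
  have hβ0 : 0 < β := by positivity
  have hα1 : α ≤ 1 := (div_le_one hp0).2 (min_le_left _ _)
  have hβ1 : β ≤ 1 := (div_le_one hr0).2 (min_le_right _ _)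
  have hαβ : α + β = q := by rw [hα, hβ, hr]; field_simp; ring
  set B := 2 * (bellmanConst α β * 2 ^ q) with hB
  have hB0 : 0 < B := by
    have := IsHeatFlow.bellmanWeight_nonneg (hαβ.symm ▸ hq1 : 1 < α + β) (β - α)
    rw [hB, bellmanConst]; positivity
  set m := (1 / (2 * B)) ^ (p - 1) with hm
  have hm0 : 0 < m := by positivity
  have hmr : m ^ r = m / (2 * B) := by
    rw [hm, ← Real.rpow_mul (by positivity), hrp]
    have : (1 / (2 * B)) ^ p = (1 / (2 * B)) ^ (p - 1) * (1 / (2 * B)) := by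
      rw [← Real.rpow_add_one (by positivity), sub_add_cancel]
    rw [this]; ring
  refine ⟨2 * B / m, by positivity, fun u hu hu' j k => ?_⟩
  set w := dirDeriv (b k) (dirDeriv (b j) u) with hw
  set f := basisLaplacian b u with hf
  have hwc : Continuous w := continuous_dirDeriv (contDiff_dirDeriv hu _) _
  have hws : HasCompactSupport w :=
    hasCompactSupport_dirDeriv (hasCompactSupport_dirDeriv hu' _) _
  have hfc : Continuous f := continuous_basisLaplacian hu
  have hfs : HasCompactSupport f := hasCompactSupport_basisLaplacian hu'
  have hcp : ∀ {φ : E → ℝ} {a : ℝ}, 0 < a → Continuous φ → Continuous fun x => |φ x| ^ a :=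
    fun ha hφ => hφ.abs.rpow_const fun _ => Or.inr ha.le
  have hsp : ∀ {φ : E → ℝ} {a : ℝ}, 0 < a → HasCompactSupport φ →
      HasCompactSupport fun x => |φ x| ^ a := fun {φ a} ha hφ =>
    hφ.comp_left (g := fun t : ℝ => |t| ^ a) (by simp [Real.zero_rpow ha.ne'])
  set g : E → ℝ := fun x => m * dualPower p (w x) with hg
  have hgc : Continuous g := continuous_const.mul ((continuous_dualPower hp).comp hwc)
  have hgs : HasCompactSupport g :=
    hws.comp_left (g := fun t : ℝ => m * dualPower p t) (by simp [dualPower_zero])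
  set h : E → ℝ := fun x => |f x| ^ (p / q) + |g x| ^ (r / q) with hh
  have hpq : 0 < p / q := by positivity
  have hrq : 0 < r / q := by positivity
  have hb := abs_integral_dirDeriv_dirDeriv_mul_le_of_contDiff (b := b) (h := h) hα0 hα1 hβ0 hβ1
    (hαβ.symm ▸ hq1) hu hu' hgc hgs ((hcp hpq hfc).add (hcp hrq hgc))
    ((hsp hpq hfs).add (hsp hrq hgs)) (fun x => by positivity) (fun x => ?_) (fun x => ?_) j k
  rotate_left
  · calc |f x| = (|f x| ^ (p / q)) ^ α := by
          rw [← Real.rpow_mul (abs_nonneg _), hα, div_mul_div_cancel₀ hq0.ne', div_self hp0.ne',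
            Real.rpow_one]
      _ ≤ _ := Real.rpow_le_rpow (by positivity) (le_add_of_nonneg_right (by positivity)) hα0.le
  · calc |g x| = (|g x| ^ (r / q)) ^ β := by
          rw [← Real.rpow_mul (abs_nonneg _), hβ, div_mul_div_cancel₀ hq0.ne', div_self hr0.ne',
            Real.rpow_one]
      _ ≤ _ := Real.rpow_le_rpow (by positivity) (le_add_of_nonneg_left (by positivity)) hβ0.le
  have hwi : Integrable fun x => |w x| ^ p :=
    (hcp hp0 hwc).integrable_of_hasCompactSupport (hsp hp0 hws)
  have hfi : Integrable fun x => |f x| ^ p :=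
    (hcp hp0 hfc).integrable_of_hasCompactSupport (hsp hp0 hfs)
  have hleft : ∫ x, w x * g x = m * ∫ x, |w x| ^ p := by
    rw [← integral_const_mul]
    refine integral_congr_ae (ae_of_all _ fun x => ?_)
    simp only [hg, ← mul_dualPower hp]
    ring
  have hright : ∫ x, h x ^ (α + β)
      ≤ 2 ^ q * ((∫ x, |f x| ^ p) + m / (2 * B) * ∫ x, |w x| ^ p) := by
    rw [← integral_const_mul, ← integral_add hfi (hwi.const_mul _), ← integral_const_mul]
    refine integral_mono_of_nonneg (ae_of_all _ fun x => by positivity)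
      ((hfi.add (hwi.const_mul _)).const_mul _) (ae_of_all _ fun x => ?_)
    have := add_rpow_le_two_rpow_mul (a := |f x| ^ (p / q)) (c := |g x| ^ (r / q))
      (by positivity) (by positivity) hq0.le
    rw [← Real.rpow_mul (abs_nonneg _), ← Real.rpow_mul (abs_nonneg _), div_mul_cancel₀ _ hq0.ne',
      div_mul_cancel₀ _ hq0.ne'] at this
    simp only [hαβ, hh]
    refine this.trans_eq ?_
    have hgr : |g x| ^ r = m / (2 * B) * |w x| ^ p := by
      rw [hg]
      simp only []
      rw [abs_mul, abs_dualPower hp, abs_of_pos hm0, Real.mul_rpow hm0.le (by positivity), hmr,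
        ← Real.rpow_mul (abs_nonneg _), hrp]
    rw [hgr]
  rw [hleft] at hb
  have h1 := (le_abs_self _).trans (hb.trans (mul_le_mul_of_nonneg_left
    (mul_le_mul_of_nonneg_left hright (by
      have : 0 < bellmanConst α β * 2 ^ q := by linarith
      exact (pos_of_mul_pos_left this (by positivity)).le)) zero_le_two))
  have h2 : m * (∫ x, |w x| ^ p) ≤ B * (∫ x, |f x| ^ p) + m / 2 * ∫ x, |w x| ^ p := by
    refine h1.trans_eq ?_
    rw [hB]
    have : bellmanConst α β * 2 ^ q ≠ 0 := by linarith
    have h3 : 2 * (bellmanConst α β * (2 ^ q * ((∫ x, |f x| ^ p)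
        + m / (2 * B) * ∫ x, |w x| ^ p))) = B * (∫ x, |f x| ^ p)
        + (B * (m / (2 * B))) * ∫ x, |w x| ^ p := by rw [hB]; ring
    rw [h3, show B * (m / (2 * B)) = m / 2 by field_simp]
  rw [div_mul_eq_mul_div, le_div_iff₀ hm0]
  linarith

end Mollification

section Interpolation

open scoped NNReal

variable {E : Type*} [NormedAddCommGroup E] [InnerProductSpace ℝ E] [FiniteDimensional ℝ E]
  [MeasurableSpace E] [BorelSpace E]

theorem AntilipschitzWith.map_volume_le {Ψ : E → E} {K : ℝ≥0} (hΨ : Continuous Ψ)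
    (hK : AntilipschitzWith K Ψ) :
    Measure.map Ψ volume ≤ (K ^ Module.finrank ℝ E) • (volume : Measure E) := by
  have hμ := Measure.isAddLeftInvariant_eq_smul (volume : Measure E)
    (Measure.hausdorffMeasure (Module.finrank ℝ E : ℝ))
  refine Measure.le_iff.2 fun s hs => ?_
  rw [Measure.map_apply hΨ.measurable hs, hμ]
  simp only [Measure.smul_apply, ENNReal.smul_def, smul_eq_mul]
  have h := hK.hausdorffMeasure_preimage_le (Nat.cast_nonneg (Module.finrank ℝ E)) s
  rw [ENNReal.rpow_natCast] at h
  rw [mul_left_comm]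
  push_cast
  gcongr

theorem AntilipschitzWith.integrable_comp {Ψ : E → E} {K : ℝ≥0} (hK : AntilipschitzWith K Ψ)
    (hΨ : Continuous Ψ) {F : E → ℝ} (hF : Integrable F) : Integrable fun x => F (Ψ x) := by
  have h1 : Integrable F (Measure.map Ψ volume) :=
    (hF.smul_measure_nnreal).mono_measure (hK.map_volume_le hΨ)
  exact (integrable_map_measure h1.1 hΨ.aemeasurable).1 h1

theorem AntilipschitzWith.integral_comp_le {Ψ : E → E} {K : ℝ≥0} (hK : AntilipschitzWith K Ψ)
    (hΨ : Continuous Ψ) {F : E → ℝ} (hF : Integrable F) (hF0 : ∀ x, 0 ≤ F x) :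
    ∫ x, F (Ψ x) ≤ K ^ Module.finrank ℝ E * ∫ x, F x := by
  have h1 : Integrable F (Measure.map Ψ volume) :=
    (hF.smul_measure_nnreal).mono_measure (hK.map_volume_le hΨ)
  rw [← integral_map hΨ.aemeasurable h1.1]
  refine (integral_mono_measure (hK.map_volume_le hΨ) (ae_of_all _ hF0)
    hF.smul_measure_nnreal).trans_eq ?_
  rw [integral_smul_nnreal_measure]
  simp [NNReal.smul_def]

/-- Taylor's formula at order two along a segment. -/
theorem sub_sub_dirDeriv_eq_integral {z : E → ℝ} (hz : ContDiff ℝ 2 z) (x v : E) :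
    z (x + v) - z x - dirDeriv v z x
      = ∫ τ in (0 : ℝ)..1, (1 - τ) * dirDeriv v (dirDeriv v z) (x + τ • v) := by
  have hl : ∀ τ : ℝ, HasDerivAt (fun τ : ℝ => x + τ • v) v τ := fun τ => by
    simpa using ((hasDerivAt_id τ).smul_const v).const_add x
  have h1 : ∀ {f : E → ℝ}, ContDiff ℝ 1 f → ∀ τ : ℝ,
      HasDerivAt (fun τ : ℝ => f (x + τ • v)) (dirDeriv v f (x + τ • v)) τ := fun hf τ =>
    ((hf.differentiable (by simp)) _).hasFDerivAt.comp_hasDerivAt τ (hl τ)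
  have hd : ∀ τ : ℝ, HasDerivAt
      (fun τ : ℝ => z (x + τ • v) + (1 - τ) * dirDeriv v z (x + τ • v))
      ((1 - τ) * dirDeriv v (dirDeriv v z) (x + τ • v)) τ := by
    intro τ
    have h2 := (h1 (hz.of_le (by norm_num)) τ).add
      (((hasDerivAt_id τ).const_sub 1).mul (h1 (contDiff_dirDeriv hz v) τ))
    refine h2.congr_deriv ?_
    simp only [id]
    ring
  have hc : Continuous fun τ : ℝ => (1 - τ) * dirDeriv v (dirDeriv v z) (x + τ • v) := by
    have := continuous_dirDeriv (contDiff_dirDeriv hz v) v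
    exact (by fun_prop : Continuous fun τ : ℝ => 1 - τ).mul (this.comp (by fun_prop))
  rw [intervalIntegral.integral_eq_sub_of_hasDerivAt (fun τ _ => hd τ) (hc.intervalIntegrable _ _)]
  simp
  ring

theorem dirDeriv_smul (a : ℝ) (v : E) (f : E → ℝ) :
    dirDeriv (a • v) f = fun x => a * dirDeriv v f x := by
  ext x; simp [dirDeriv]

theorem integral_Ioc_rpow_le {g : ℝ → ℝ} {p : ℝ} (hp : 1 ≤ p) (hg : Continuous g)
    (hg0 : ∀ t, 0 ≤ g t) : (∫ τ in Ioc (0 : ℝ) 1, g τ) ^ p ≤ ∫ τ in Ioc (0 : ℝ) 1, g τ ^ p := by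
  have : IsProbabilityMeasure (volume.restrict (Ioc (0 : ℝ) 1)) := ⟨by simp⟩
  have hi : ∀ {f : ℝ → ℝ}, Continuous f → IntegrableOn f (Ioc 0 1) := fun hf =>
    (hf.continuousOn.integrableOn_Icc (a := 0) (b := 1)).mono_set Ioc_subset_Icc_self
  have hpc : Continuous fun t : ℝ => t ^ p := Real.continuous_rpow_const (by linarith)
  exact ConvexOn.map_integral_le (convexOn_rpow hp) hpc.continuousOn isClosed_Ici
    (ae_of_all _ hg0) (hi hg) (hi (hpc.comp hg))

variable {η z : E → ℝ} {e : E} {ε L p : ℝ}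

/-- The displacement along `e` with a step proportional to `η`. -/
noncomputable def shift (η : E → ℝ) (e : E) (t : ℝ) (x : E) : E := x + (t * η x) • e

theorem antilipschitzWith_shift (hη : ∀ x y, |η x - η y| ≤ L * ‖x - y‖) (he : ‖e‖ ≤ 1) {t : ℝ}
    (ht : |t| * L ≤ 1 / 2) : AntilipschitzWith 2 (shift η e t) := by
  refine AntilipschitzWith.of_le_mul_dist fun x y => ?_
  rw [dist_eq_norm, dist_eq_norm]
  have h1 : x - y = (shift η e t x - shift η e t y) - (t * (η x - η y)) • e := by
    simp only [shift]; module
  have h2 : ‖(t * (η x - η y)) • e‖ ≤ 1 / 2 * ‖x - y‖ := by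
    rw [norm_smul, norm_mul, Real.norm_eq_abs, Real.norm_eq_abs]
    calc |t| * |η x - η y| * ‖e‖ ≤ |t| * (L * ‖x - y‖) * 1 := by
          have h := hη x y
          have h' := (abs_nonneg _).trans h
          gcongr
      _ = |t| * L * ‖x - y‖ := by ring
      _ ≤ _ := by gcongr
  have h3 : ‖x - y‖ ≤ ‖shift η e t x - shift η e t y‖ + ‖(t * (η x - η y)) • e‖ := by
    conv_lhs => rw [h1]
    exact norm_sub_le _ _
  simp only [NNReal.coe_ofNat]
  linarith

theorem abs_apply_shift_sub_le (hη : ∀ x y, |η x - η y| ≤ L * ‖x - y‖) (hη0 : ∀ x, 0 ≤ η x)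
    (hL : 0 ≤ L) (he : ‖e‖ ≤ 1) {t : ℝ} (ht : |t| * L ≤ 1 / 2) (x : E) :
    |η (shift η e t x) - η x| ≤ η x / 2 := by
  refine (hη _ _).trans ?_
  rw [shift, add_sub_cancel_left, norm_smul, norm_mul, Real.norm_eq_abs, Real.norm_eq_abs,
    abs_of_nonneg (hη0 x)]
  calc L * (|t| * η x * ‖e‖) ≤ L * (|t| * η x * 1) := by
        have := hη0 x
        gcongr
    _ = |t| * L * η x := by ring
    _ ≤ 1 / 2 * η x := by have := hη0 x; gcongr
    _ = _ := by ring

/-- Pointwise interpolation with a variable step. -/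
theorem mul_abs_dirDeriv_le (hz : ContDiff ℝ 2 z) (hη : ∀ x y, |η x - η y| ≤ L * ‖x - y‖)
    (hη0 : ∀ x, 0 ≤ η x) (hηc : Continuous η) (hL : 0 ≤ L) (he : ‖e‖ ≤ 1) (hε : 0 < ε)
    (hεL : ε * L ≤ 1 / 2) (x : E) :
    ε * η x * |dirDeriv e z x| ≤ |z (shift η e ε x)| + |z x| + 4 * ε ^ 2 *
      ∫ τ in Ioc (0 : ℝ) 1, η (shift η e (τ * ε) x) ^ 2
        * |dirDeriv e (dirDeriv e z) (shift η e (τ * ε) x)| := by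
  set a := ε * η x with ha
  have ha0 : 0 ≤ a := mul_nonneg hε.le (hη0 x)
  have hT := sub_sub_dirDeriv_eq_integral hz x (a • e)
  have hs : ∀ τ : ℝ, shift η e (τ * ε) x = x + τ • a • e := fun τ => by
    rw [shift, smul_smul, ha, mul_assoc]
  have hs1 : shift η e ε x = x + a • e := rfl
  have hDc : Continuous (dirDeriv e (dirDeriv e z)) :=
    continuous_dirDeriv (contDiff_dirDeriv hz e) e
  have hc1 : Continuous fun τ : ℝ => x + τ • a • e := by fun_prop
  have hintg : |∫ τ in (0 : ℝ)..1, (1 - τ) * dirDeriv (a • e) (dirDeriv (a • e) z) (x + τ • a • e)|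
      ≤ 4 * ε ^ 2 * ∫ τ in Ioc (0 : ℝ) 1, η (shift η e (τ * ε) x) ^ 2
        * |dirDeriv e (dirDeriv e z) (shift η e (τ * ε) x)| := by
    rw [intervalIntegral.integral_of_le zero_le_one, ← integral_const_mul, ← Real.norm_eq_abs]
    refine norm_integral_le_of_norm_le ?_ ((ae_restrict_iff' measurableSet_Ioc).2
      (ae_of_all _ fun τ hτ => ?_))
    · simp only [hs]
      have : Continuous fun τ : ℝ => 4 * ε ^ 2 * (η (x + τ • a • e) ^ 2
          * |dirDeriv e (dirDeriv e z) (x + τ • a • e)|) :=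
        continuous_const.mul (((hηc.comp hc1).pow 2).mul (hDc.comp hc1).abs)
      exact (this.continuousOn.integrableOn_Icc (a := 0) (b := 1)).mono_set Ioc_subset_Icc_self
    · rw [dirDeriv_smul a e z, dirDeriv_const_mul, dirDeriv_smul a e (dirDeriv e z)]
      simp only []
      rw [hs τ]
      set D := dirDeriv e (dirDeriv e z) (x + τ • a • e) with hD
      have hle : |τ * ε| * L ≤ 1 / 2 := by
        rw [abs_of_nonneg (mul_nonneg hτ.1.le hε.le)]
        calc τ * ε * L ≤ 1 * ε * L := by gcongr; exact hτ.2
          _ ≤ _ := by linarith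
      have h1 := abs_apply_shift_sub_le (e := e) hη hη0 hL he hle x
      rw [hs τ] at h1
      have h2 : η x ≤ 2 * η (x + τ • a • e) := by
        have := (abs_le.1 h1).1; linarith
      have h3 : η x ^ 2 ≤ 4 * η (x + τ • a • e) ^ 2 := by
        have := pow_le_pow_left₀ (hη0 x) h2 2
        linarith
      rw [Real.norm_eq_abs, abs_mul, abs_mul a, abs_mul a, abs_of_nonneg ha0,
        abs_of_nonneg (by linarith [hτ.2] : 0 ≤ 1 - τ)]
      calc (1 - τ) * (a * (a * |D|)) ≤ 1 * (a * (a * |D|)) := by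
            gcongr; linarith [hτ.1]
        _ = ε ^ 2 * (η x ^ 2 * |D|) := by rw [ha]; ring
        _ ≤ ε ^ 2 * (4 * η (x + τ • a • e) ^ 2 * |D|) := by gcongr
        _ = _ := by ring
  rw [← hT, dirDeriv_smul, hs1.symm] at hintg
  simp only [] at hintg
  have h5 : a * |dirDeriv e z x| = |a * dirDeriv e z x| := by rw [abs_mul, abs_of_nonneg ha0]
  rw [h5]
  have h6 : |a * dirDeriv e z x| ≤ |z (shift η e ε x)| + |z x|
      + |z (shift η e ε x) - z x - a * dirDeriv e z x| := by
    have e1 := abs_sub (z (shift η e ε x) - z x) (z (shift η e ε x) - z x - a * dirDeriv e z x)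
    have e2 := abs_sub (z (shift η e ε x)) (z x)
    have e3 : z (shift η e ε x) - z x - (z (shift η e ε x) - z x - a * dirDeriv e z x)
      = a * dirDeriv e z x := by ring
    rw [e3] at e1
    linarith
  linarith

theorem add_add_rpow_le {a c d : ℝ} (ha : 0 ≤ a) (hc : 0 ≤ c) (hd : 0 ≤ d) (hp : 1 ≤ p) :
    (a + c + d) ^ p ≤ 4 ^ p * (a ^ p + c ^ p + d ^ p) := by
  have hp0 : 0 ≤ p := by linarith
  have h1 := add_rpow_le_two_rpow_mul (add_nonneg ha hc) hd hp0
  have h2 := add_rpow_le_two_rpow_mul ha hc hp0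
  have h4 : (4 : ℝ) ^ p = 2 ^ p * 2 ^ p := by
    rw [← Real.mul_rpow (by norm_num) (by norm_num)]; norm_num
  have h5 : (1 : ℝ) ≤ 2 ^ p := Real.one_le_rpow (by norm_num) hp0
  have hdp := Real.rpow_nonneg hd p
  rw [h4]
  calc (a + c + d) ^ p ≤ 2 ^ p * (2 ^ p * (a ^ p + c ^ p) + d ^ p) := h1.trans (by gcongr)
    _ ≤ 2 ^ p * (2 ^ p * (a ^ p + c ^ p) + 2 ^ p * d ^ p) := by
        gcongr; exact le_mul_of_one_le_left hdp h5
    _ = _ := by ring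

/-- Interpolation of first derivatives with the weight `η`. -/
theorem integral_rpow_mul_abs_dirDeriv_le (hp : 1 ≤ p) (hz : ContDiff ℝ 2 z)
    (hη : ∀ x y, |η x - η y| ≤ L * ‖x - y‖) (hη0 : ∀ x, 0 ≤ η x) (hηc : Continuous η)
    (hηs : HasCompactSupport η) (hL : 0 ≤ L) (he : ‖e‖ ≤ 1) (hε : 0 < ε) (hεL : ε * L ≤ 1 / 2) :
    ε ^ p * ∫ x, (η x * |dirDeriv e z x|) ^ p ≤ 4 ^ p * ((2 ^ Module.finrank ℝ E + 1)
      * (∫ x in {x | 0 < η x}, |z x| ^ p) + (4 * ε ^ 2) ^ p * (2 ^ Module.finrank ℝ E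
      * ∫ x, (η x ^ 2 * |dirDeriv e (dirDeriv e z) x|) ^ p)) := by
  have hp0 : 0 < p := by linarith
  set d := Module.finrank ℝ E
  set P : Set E := {x | 0 < η x} with hP
  have hPm : MeasurableSet P := (isOpen_lt continuous_const hηc).measurableSet
  have hzc : Continuous fun x => |z x| ^ p := hz.continuous.abs.rpow_const fun _ => Or.inr hp0.le
  set Z : E → ℝ := P.indicator fun x => |z x| ^ p with hZ
  have hZ0 : ∀ x, 0 ≤ Z x := fun x => indicator_nonneg (fun x _ => by positivity) x
  have hZi : Integrable Z := by
    rw [hZ, integrable_indicator_iff hPm]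
    refine (hzc.continuousOn.integrableOn_compact hηs).mono_set fun x hx => ?_
    exact subset_closure (ne_of_gt hx)
  have hZint : ∫ x, Z x = ∫ x in P, |z x| ^ p := integral_indicator hPm
  have hDc : Continuous (dirDeriv e (dirDeriv e z)) :=
    continuous_dirDeriv (contDiff_dirDeriv hz e) e
  set W : E → ℝ := fun x => η x ^ 2 * |dirDeriv e (dirDeriv e z) x| with hW
  have hW0 : ∀ x, 0 ≤ W x := fun x => by positivity
  have hWc : Continuous W := (hηc.pow 2).mul hDc.abs
  have hWpc : Continuous fun x => W x ^ p := hWc.rpow_const fun _ => Or.inr hp0.le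
  have hWs : HasCompactSupport fun x => W x ^ p := by
    refine HasCompactSupport.intro hηs fun x hx => ?_
    simp [hW, image_eq_zero_of_notMem_tsupport hx, Real.zero_rpow hp0.ne']
  have hWi : Integrable fun x => W x ^ p := hWpc.integrable_of_hasCompactSupport hWs
  have hsc : Continuous fun q : ℝ × E => shift η e (q.1 * ε) q.2 := by
    unfold shift; fun_prop
  have hsct : ∀ t, Continuous (shift η e t) := fun t => by unfold shift; fun_prop
  have hsmall : ∀ τ ∈ Ioc (0 : ℝ) 1, |τ * ε| * L ≤ 1 / 2 := fun τ hτ => by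
    rw [abs_of_nonneg (mul_nonneg hτ.1.le hε.le)]
    calc τ * ε * L ≤ 1 * ε * L := by gcongr; exact hτ.2
      _ ≤ _ := by linarith
  have hεL' : |ε| * L ≤ 1 / 2 := by rwa [abs_of_pos hε]
  have hprod : Integrable (fun q : ℝ × E => W (shift η e (q.1 * ε) q.2) ^ p)
      ((volume.restrict (Ioc (0 : ℝ) 1)).prod volume) := by
    have hc : Continuous fun q : ℝ × E => W (shift η e (q.1 * ε) q.2) ^ p := hWpc.comp hsc
    have h1 : IntegrableOn (fun q : ℝ × E => W (shift η e (q.1 * ε) q.2) ^ p)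
        (Icc (0 : ℝ) 1 ×ˢ tsupport η) ((volume : Measure ℝ).prod (volume : Measure E)) :=
      hc.continuousOn.integrableOn_compact (isCompact_Icc.prod hηs)
    rw [← Measure.restrict_univ (μ := (volume : Measure E)), Measure.prod_restrict]
    refine IntegrableOn.of_forall_sdiff_eq_zero h1 (measurableSet_Ioc.prod MeasurableSet.univ) ?_
    rintro ⟨τ, x⟩ ⟨h2, h3⟩
    have hx : x ∉ tsupport η := fun hx => h3 ⟨Ioc_subset_Icc_self h2.1, hx⟩
    have hx0 := image_eq_zero_of_notMem_tsupport hx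
    simp [hW, shift, hx0, Real.zero_rpow hp0.ne']
  have hpt : ∀ x, (ε * η x * |dirDeriv e z x|) ^ p ≤ 4 ^ p * (Z (shift η e ε x) + Z x
      + (4 * ε ^ 2) ^ p * ∫ τ in Ioc (0 : ℝ) 1, W (shift η e (τ * ε) x) ^ p) := by
    intro x
    have hI0 : 0 ≤ ∫ τ in Ioc (0 : ℝ) 1, W (shift η e (τ * ε) x) ^ p :=
      integral_nonneg fun τ => Real.rpow_nonneg (hW0 _) _
    rcases (hη0 x).eq_or_lt with h0 | h0
    · rw [← h0, mul_zero, zero_mul, Real.zero_rpow hp0.ne']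
      have := hZ0 x
      have := hZ0 (shift η e ε x)
      positivity
    · have h1 := mul_abs_dirDeriv_le hz hη hη0 hηc hL he hε hεL x
      have hJ0 : 0 ≤ ∫ τ in Ioc (0 : ℝ) 1, W (shift η e (τ * ε) x) :=
        integral_nonneg fun τ => hW0 _
      have h2 := Real.rpow_le_rpow (by positivity) h1 hp0.le
      refine h2.trans ((add_add_rpow_le (abs_nonneg _) (abs_nonneg _)
        (mul_nonneg (by positivity) hJ0) hp).trans ?_)
      have hmem : shift η e ε x ∈ P := by
        have := (abs_le.1 (abs_apply_shift_sub_le (e := e) hη hη0 hL he hεL' x)).1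
        change 0 < η _
        linarith
      have e1 : Z (shift η e ε x) = |z (shift η e ε x)| ^ p := indicator_of_mem hmem _
      have e2 : Z x = |z x| ^ p := indicator_of_mem (show x ∈ P from h0) _
      rw [e1, e2, Real.mul_rpow (by positivity) hJ0]
      have h3 := integral_Ioc_rpow_le hp (g := fun τ => W (shift η e (τ * ε) x))
        (hWc.comp (hsc.comp (Continuous.prodMk_left x))) fun τ => hW0 _
      gcongr
  have hanti := antilipschitzWith_shift (e := e) hη he hεL'
  have hZ1 := hanti.integrable_comp (hsct ε) hZi
  have hJi := hprod.integral_prod_right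
  have hJle : ∫ x, ∫ τ in Ioc (0 : ℝ) 1, W (shift η e (τ * ε) x) ^ p
      ≤ 2 ^ d * ∫ x, W x ^ p := by
    rw [← integral_integral_swap hprod]
    have hle : ∀ τ ∈ Ioc (0 : ℝ) 1, ∫ x, W (shift η e (τ * ε) x) ^ p ≤ 2 ^ d * ∫ x, W x ^ p :=
      fun τ hτ => by
        simpa using (antilipschitzWith_shift (e := e) hη he (hsmall τ hτ)).integral_comp_le
          (hsct _) hWi fun x => Real.rpow_nonneg (hW0 x) p
    refine (setIntegral_mono_on hprod.integral_prod_left (integrableOn_const (by simp))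
      measurableSet_Ioc hle).trans_eq ?_
    simp
  have hmain := integral_mono_of_nonneg (μ := (volume : Measure E))
    (f := fun x => (ε * η x * |dirDeriv e z x|) ^ p)
    (ae_of_all _ fun x => Real.rpow_nonneg (mul_nonneg (mul_nonneg hε.le (hη0 x)) (abs_nonneg _)) p)
    (((hZ1.add hZi).add (hJi.const_mul ((4 * ε ^ 2) ^ p))).const_mul (4 ^ p)) (ae_of_all _ hpt)
  have hl : ∫ x, (ε * η x * |dirDeriv e z x|) ^ p = ε ^ p * ∫ x, (η x * |dirDeriv e z x|) ^ p := by
    rw [← integral_const_mul]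
    refine integral_congr_ae (ae_of_all _ fun x => ?_)
    simp only []
    rw [mul_assoc, Real.mul_rpow hε.le (mul_nonneg (hη0 x) (abs_nonneg _))]
  rw [← hl]
  refine hmain.trans ?_
  have hsplit : ∫ x, 4 ^ p * (Z (shift η e ε x) + Z x
      + (4 * ε ^ 2) ^ p * ∫ τ in Ioc (0 : ℝ) 1, W (shift η e (τ * ε) x) ^ p)
      = 4 ^ p * ((∫ x, Z (shift η e ε x)) + (∫ x, Z x)
      + (4 * ε ^ 2) ^ p * ∫ x, ∫ τ in Ioc (0 : ℝ) 1, W (shift η e (τ * ε) x) ^ p) := by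
    have i1 : Integrable fun x => Z (shift η e ε x) + Z x := hZ1.add hZi
    have i2 : Integrable fun x => (4 * ε ^ 2) ^ p
        * ∫ τ in Ioc (0 : ℝ) 1, W (shift η e (τ * ε) x) ^ p := hJi.const_mul _
    rw [integral_const_mul, integral_add i1 i2, integral_const_mul, integral_add hZ1 hZi]
  have hZle : ∫ x, Z (shift η e ε x) ≤ 2 ^ d * ∫ x, Z x := by
    simpa using hanti.integral_comp_le (hsct ε) hZi hZ0
  refine hsplit.trans_le ?_
  rw [← hZint]
  have : (∫ x, Z (shift η e ε x)) + ∫ x, Z x ≤ (2 ^ d + 1) * ∫ x, Z x := by linarith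
  gcongr

end Interpolation

section InteriorEstimate

variable {E : Type*} [NormedAddCommGroup E] [InnerProductSpace ℝ E] [FiniteDimensional ℝ E]
  [MeasurableSpace E] [BorelSpace E] {ι : Type*} [Fintype ι] {b : OrthonormalBasis ι ℝ E}

theorem dirDeriv_mul {f g : E → ℝ} (hf : Differentiable ℝ f) (hg : Differentiable ℝ g) (v : E) :
    dirDeriv v (fun x => f x * g x) = fun x => f x * dirDeriv v g x + g x * dirDeriv v f x := by
  ext x
  simp only [dirDeriv]
  rw [fderiv_fun_mul (hf x) (hg x)]
  simp

theorem dirDeriv_add {f g : E → ℝ} (hf : Differentiable ℝ f) (hg : Differentiable ℝ g) (v : E) :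
    dirDeriv v (fun x => f x + g x) = fun x => dirDeriv v f x + dirDeriv v g x := by
  ext x
  simp only [dirDeriv]
  rw [fderiv_fun_add (hf x) (hg x)]
  simp

theorem dirDeriv_dirDeriv_mul {f g : E → ℝ} (hf : ContDiff ℝ 2 f) (hg : ContDiff ℝ 2 g)
    (v w : E) (x : E) :
    dirDeriv v (dirDeriv w fun x => f x * g x) x = f x * dirDeriv v (dirDeriv w g) x
      + (dirDeriv v f x * dirDeriv w g x + dirDeriv w f x * dirDeriv v g x)
      + g x * dirDeriv v (dirDeriv w f) x := by
  have df := hf.differentiable (by norm_num)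
  have dg := hg.differentiable (by norm_num)
  have df' := (contDiff_dirDeriv hf w).differentiable (by norm_num)
  have dg' := (contDiff_dirDeriv hg w).differentiable (by norm_num)
  rw [dirDeriv_mul df dg, dirDeriv_add (f := fun x => f x * dirDeriv w g x)
    (g := fun x => g x * dirDeriv w f x) (df.mul dg') (dg.mul df'), dirDeriv_mul df dg',
    dirDeriv_mul dg df']
  ring

variable {η z : E → ℝ} {p : ℝ}

/-- The lower order terms produced by localizing second derivatives. -/
noncomputable def lowerOrder (b : OrthonormalBasis ι ℝ E) (η z : E → ℝ) (x : E) : ℝ :=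
  ∑ i, η x * |dirDeriv (b i) z x| + (tsupport η).indicator (fun x => |z x|) x

theorem lowerOrder_nonneg (hη0 : ∀ x, 0 ≤ η x) (x : E) : 0 ≤ lowerOrder b η z x :=
  add_nonneg (Finset.sum_nonneg fun _ _ => mul_nonneg (hη0 x) (abs_nonneg _))
    (indicator_nonneg (fun _ _ => abs_nonneg _) x)

theorem integrable_indicator_rpow {f : E → ℝ} (hf : Continuous f) (hη : HasCompactSupport η)
    (hp : 0 ≤ p) : Integrable ((tsupport η).indicator fun x => |f x| ^ p) := by
  rw [integrable_indicator_iff hη.measurableSet]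
  exact (hf.abs.rpow_const fun _ => Or.inr hp).continuousOn.integrableOn_compact hη

theorem integrable_mul_abs_rpow {f : E → ℝ} (hf : Continuous f) (hη : IsTest η)
    (hp : 0 < p) : Integrable fun x => (η x * |f x|) ^ p := by
  refine ((hη.continuous.mul hf.abs).rpow_const fun _ =>
    Or.inr hp.le).integrable_of_hasCompactSupport ?_
  exact hη.hasCompactSupport.mul_right.comp_left (g := fun t : ℝ => t ^ p)
    (Real.zero_rpow hp.ne')

theorem indicator_rpow_eq {f : E → ℝ} {s : Set E} (hp : 0 < p) (x : E) :
    s.indicator (fun x => |f x|) x ^ p = s.indicator (fun x => |f x| ^ p) x := by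
  by_cases hx : x ∈ s
  · simp [hx]
  · simp [hx, Real.zero_rpow hp.ne']

theorem exists_integral_lowerOrder_rpow_le (b : OrthonormalBasis ι ℝ E) (hp : 1 < p)
    (hη : IsTest η) (hη0 : ∀ x, 0 ≤ η x) : ∃ c ≥ 0, ∀ z : E → ℝ, ContDiff ℝ 2 z →
      Integrable (fun x => lowerOrder b η z x ^ p) ∧
      ∫ x, lowerOrder b η z x ^ p
        ≤ c * ((∑ i, ∫ x, (η x * |dirDeriv (b i) z x|) ^ p) + ∫ x in tsupport η, |z x| ^ p) := by
  have hp0 : 0 < p := by linarith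
  set m : ℝ := (Fintype.card ι : ℝ) ^ (p - 1) with hm
  have hm0 : 0 ≤ m := by positivity
  refine ⟨2 ^ p * (m + 1), by positivity, fun z hz => ?_⟩
  have hi : ∀ i, Integrable fun x => (η x * |dirDeriv (b i) z x|) ^ p := fun i =>
    integrable_mul_abs_rpow (continuous_dirDeriv (hz.of_le (by norm_num)) _) hη hp0
  have hz' := integrable_indicator_rpow hz.continuous hη.hasCompactSupport hp0.le
  have hpt : ∀ x, lowerOrder b η z x ^ p ≤ 2 ^ p * (m + 1) *
      ((∑ i, (η x * |dirDeriv (b i) z x|) ^ p)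
        + (tsupport η).indicator (fun x => |z x| ^ p) x) := by
    intro x
    have hs0 : ∀ i, 0 ≤ η x * |dirDeriv (b i) z x| := fun i => mul_nonneg (hη0 x) (abs_nonneg _)
    have h1 := add_rpow_le_two_rpow_mul (Finset.sum_nonneg fun i (_ : i ∈ Finset.univ) => hs0 i)
      (indicator_nonneg (s := tsupport η) (f := fun x => |z x|) (fun _ _ => abs_nonneg _) x) hp0.le
    have h2 := Real.rpow_sum_le_const_mul_sum_rpow Finset.univ
      (fun i => η x * |dirDeriv (b i) z x|) hp.le
    simp only [abs_of_nonneg (hs0 _), Finset.card_univ] at h2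
    rw [indicator_rpow_eq hp0] at h1
    have h3 : 0 ≤ ∑ i, (η x * |dirDeriv (b i) z x|) ^ p :=
      Finset.sum_nonneg fun i _ => Real.rpow_nonneg (hs0 i) p
    have h4 : 0 ≤ (tsupport η).indicator (fun x => |z x| ^ p) x :=
      indicator_nonneg (fun _ _ => by positivity) x
    refine h1.trans ?_
    rw [mul_assoc]
    refine mul_le_mul_of_nonneg_left ?_ (by positivity)
    nlinarith [mul_nonneg hm0 h4]
  have hintg : Integrable fun x => 2 ^ p * (m + 1) * ((∑ i, (η x * |dirDeriv (b i) z x|) ^ p)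
        + (tsupport η).indicator (fun x => |z x| ^ p) x) :=
    ((integrable_finsetSum _ fun i _ => hi i).add hz').const_mul _
  have hms : AEStronglyMeasurable (fun x => lowerOrder b η z x ^ p) volume := by
    have h1 : Measurable fun x => ∑ i, η x * |dirDeriv (b i) z x| :=
      (continuous_finsetSum _ fun i _ => hη.continuous.mul
        (continuous_dirDeriv (hz.of_le (by norm_num)) _).abs).measurable
    have h2 : Measurable ((tsupport η).indicator fun x => |z x|) :=
      hz.continuous.abs.measurable.indicator hη.hasCompactSupport.measurableSet
    exact ((h1.add h2).pow_const p).aestronglyMeasurable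
  refine ⟨hintg.mono' hms (ae_of_all _ fun x => ?_), ?_⟩
  · rw [Real.norm_of_nonneg (Real.rpow_nonneg (lowerOrder_nonneg hη0 x) p)]
    exact hpt x
  · refine (integral_mono_of_nonneg (ae_of_all _ fun x =>
      Real.rpow_nonneg (lowerOrder_nonneg hη0 x) p) hintg (ae_of_all _ hpt)).trans_eq ?_
    rw [integral_const_mul, integral_add (integrable_finsetSum _ fun i _ => hi i) hz',
      integral_finsetSum _ fun i _ => hi i, integral_indicator hη.hasCompactSupport.measurableSet]

theorem exists_abs_localization_le (b : OrthonormalBasis ι ℝ E) (hη : IsTest η)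
    (hη0 : ∀ x, 0 ≤ η x) (hη1 : ∀ x, η x ≤ 1) : ∃ M ≥ 0, ∀ z : E → ℝ, ContDiff ℝ 2 z → ∀ x,
      (∀ j k, η x ^ 2 * |dirDeriv (b k) (dirDeriv (b j) z) x|
        ≤ |dirDeriv (b k) (dirDeriv (b j) fun x => η x ^ 2 * z x) x| + M * lowerOrder b η z x) ∧
      |basisLaplacian b (fun x => η x ^ 2 * z x) x|
        ≤ (tsupport η).indicator (fun x => |basisLaplacian b z x|) x
          + M * lowerOrder b η z x := by
  have hθ : IsTest fun x => η x ^ 2 := ⟨hη.contDiff.pow 2, hη.hasCompactSupport.comp_left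
    (g := fun t : ℝ => t ^ 2) (by norm_num)⟩
  have hθ2 : ContDiff ℝ 2 fun x => η x ^ 2 := contDiff_infty.1 hθ.contDiff 2
  choose M₁ hM₁ using fun i => (hη.dirDeriv (b i)).exists_bound
  choose M₂ hM₂ using fun q : ι × ι => ((hθ.dirDeriv (b q.2)).dirDeriv (b q.1)).exists_bound
  have hM₁0 : ∀ i, 0 ≤ M₁ i := fun i => (norm_nonneg _).trans (hM₁ i 0)
  have hM₂0 : ∀ i, 0 ≤ M₂ i := fun i => (norm_nonneg _).trans (hM₂ i 0)
  set M := 2 * (∑ i, M₁ i) + ∑ q, M₂ q with hM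
  have hsum1 : 0 ≤ ∑ i, M₁ i := Finset.sum_nonneg fun i _ => hM₁0 i
  have hsum2 : 0 ≤ ∑ q, M₂ q := Finset.sum_nonneg fun i _ => hM₂0 i
  have hM0 : 0 ≤ M := by positivity
  have hD1 : ∀ i x, |dirDeriv (b i) (fun x => η x ^ 2) x| ≤ M * η x := by
    intro i x
    have h1 : dirDeriv (b i) (fun x => η x ^ 2) x = 2 * (η x * dirDeriv (b i) η x) := by
      have := congrFun (dirDeriv_mul hη.differentiable hη.differentiable (b i)) x
      simp only [pow_two]
      rw [this]; ring
    rw [h1, abs_mul, abs_mul, abs_two, abs_of_nonneg (hη0 x)]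
    have h2 : |dirDeriv (b i) η x| ≤ ∑ i, M₁ i := (hM₁ i x).trans
      (Finset.single_le_sum (fun i _ => hM₁0 i) (Finset.mem_univ i))
    calc 2 * (η x * |dirDeriv (b i) η x|) ≤ 2 * (η x * ∑ i, M₁ i) := by
          have := hη0 x
          gcongr
      _ = (2 * ∑ i, M₁ i) * η x := by ring
      _ ≤ M * η x := mul_le_mul_of_nonneg_right (by linarith) (hη0 x)
  have hθsupp : tsupport (fun x => η x ^ 2) ⊆ tsupport η :=
    closure_mono fun x hx h => hx (by simp only [h]; norm_num)
  have hD2 : ∀ (z : E → ℝ) j k x, |z x * dirDeriv (b k) (dirDeriv (b j) fun x => η x ^ 2) x|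
      ≤ M * (tsupport η).indicator (fun x => |z x|) x := by
    intro z j k x
    by_cases hx : x ∈ tsupport η
    · rw [indicator_of_mem hx, abs_mul, mul_comm]
      have h2 := (hM₂ (k, j) x).trans
        (Finset.single_le_sum (fun i _ => hM₂0 i) (Finset.mem_univ (k, j)))
      rw [Real.norm_eq_abs] at h2
      exact mul_le_mul_of_nonneg_right (by linarith) (abs_nonneg _)
    · have : dirDeriv (b k) (dirDeriv (b j) fun x => η x ^ 2) x = 0 :=
        image_eq_zero_of_notMem_tsupport fun h => hx (hθsupp
          ((tsupport_fderiv_apply_subset ℝ _).trans (tsupport_fderiv_apply_subset ℝ _) h))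
      simp [this, hx]
  refine ⟨(Fintype.card ι + 2) * M, by positivity, fun z hz x => ?_⟩
  set I := (tsupport η).indicator (fun x => |z x|) x with hI
  have hI0 : 0 ≤ I := indicator_nonneg (fun _ _ => abs_nonneg _) x
  set A := ∑ i, η x * |dirDeriv (b i) z x| with hA
  have hA0 : ∀ i, 0 ≤ η x * |dirDeriv (b i) z x| := fun i => mul_nonneg (hη0 x) (abs_nonneg _)
  have hA0' : 0 ≤ A := Finset.sum_nonneg fun i _ => hA0 i
  have hLO : lowerOrder b η z x = A + I := rfl
  have hcross : ∀ i j, |dirDeriv (b i) (fun x => η x ^ 2) x * dirDeriv (b j) z x|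
      ≤ M * (η x * |dirDeriv (b j) z x|) := fun i j => by
    rw [abs_mul, ← mul_assoc]
    exact mul_le_mul_of_nonneg_right (hD1 i x) (abs_nonneg _)
  have hsingle : ∀ i, η x * |dirDeriv (b i) z x| ≤ A := fun i =>
    Finset.single_le_sum (fun i _ => hA0 i) (Finset.mem_univ i)
  have hcard : (0 : ℝ) ≤ Fintype.card ι := Nat.cast_nonneg _
  constructor
  · intro j k
    have h := dirDeriv_dirDeriv_mul hθ2 hz (b k) (b j) x
    have h1 : η x ^ 2 * dirDeriv (b k) (dirDeriv (b j) z) x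
        = dirDeriv (b k) (dirDeriv (b j) fun x => η x ^ 2 * z x) x
          - dirDeriv (b k) (fun x => η x ^ 2) x * dirDeriv (b j) z x
          - dirDeriv (b j) (fun x => η x ^ 2) x * dirDeriv (b k) z x
          - z x * dirDeriv (b k) (dirDeriv (b j) fun x => η x ^ 2) x := by rw [h]; ring
    have h2 : η x ^ 2 * |dirDeriv (b k) (dirDeriv (b j) z) x|
        = |η x ^ 2 * dirDeriv (b k) (dirDeriv (b j) z) x| := by
      rw [abs_mul, abs_of_nonneg (sq_nonneg (η x))]
    rw [h2, h1, hLO]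
    have e1 := hcross k j
    have e2 := hcross j k
    have e3 := hD2 z j k x
    have e4 := mul_le_mul_of_nonneg_left (hsingle j) hM0
    have e5 := mul_le_mul_of_nonneg_left (hsingle k) hM0
    have t1 := abs_sub (dirDeriv (b k) (dirDeriv (b j) fun x => η x ^ 2 * z x) x
          - dirDeriv (b k) (fun x => η x ^ 2) x * dirDeriv (b j) z x
          - dirDeriv (b j) (fun x => η x ^ 2) x * dirDeriv (b k) z x)
          (z x * dirDeriv (b k) (dirDeriv (b j) fun x => η x ^ 2) x)
    have t2 := abs_sub (dirDeriv (b k) (dirDeriv (b j) fun x => η x ^ 2 * z x) x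
          - dirDeriv (b k) (fun x => η x ^ 2) x * dirDeriv (b j) z x)
          (dirDeriv (b j) (fun x => η x ^ 2) x * dirDeriv (b k) z x)
    have t3 := abs_sub (dirDeriv (b k) (dirDeriv (b j) fun x => η x ^ 2 * z x) x)
          (dirDeriv (b k) (fun x => η x ^ 2) x * dirDeriv (b j) z x)
    have f1 : 0 ≤ (Fintype.card ι : ℝ) * (M * (A + I)) := by positivity
    have f2 : 0 ≤ M * I := by positivity
    linarith
  · have h1 : basisLaplacian b (fun x => η x ^ 2 * z x) x = η x ^ 2 * basisLaplacian b z x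
        + ∑ i, (2 * (dirDeriv (b i) (fun x => η x ^ 2) x * dirDeriv (b i) z x)
          + z x * dirDeriv (b i) (dirDeriv (b i) fun x => η x ^ 2) x) := by
      simp only [basisLaplacian]
      rw [Finset.mul_sum, ← Finset.sum_add_distrib]
      refine Finset.sum_congr rfl fun i _ => ?_
      rw [dirDeriv_dirDeriv_mul hθ2 hz]; ring
    rw [h1, hLO]
    refine (abs_add_le _ _).trans (add_le_add ?_ ?_)
    · by_cases hx : x ∈ tsupport η
      · rw [indicator_of_mem hx, abs_mul, abs_of_nonneg (sq_nonneg (η x))]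
        exact mul_le_of_le_one_left (abs_nonneg _) (pow_le_one₀ (hη0 x) (hη1 x))
      · simp [image_eq_zero_of_notMem_tsupport hx, hx]
    · have h2 : ∀ i, |2 * (dirDeriv (b i) (fun x => η x ^ 2) x * dirDeriv (b i) z x)
          + z x * dirDeriv (b i) (dirDeriv (b i) fun x => η x ^ 2) x|
          ≤ 2 * M * (η x * |dirDeriv (b i) z x|) + M * I := by
        intro i
        refine (abs_add_le _ _).trans (add_le_add ?_ (hD2 z i i x))
        rw [abs_mul, abs_two, mul_assoc]
        exact mul_le_mul_of_nonneg_left (hcross i i) zero_le_two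
      refine (Finset.abs_sum_le_sum_abs _ _).trans
        ((Finset.sum_le_sum fun i _ => h2 i).trans ?_)
      rw [Finset.sum_add_distrib, ← Finset.mul_sum, Finset.sum_const, Finset.card_univ,
        nsmul_eq_mul]
      have f1 : 0 ≤ (Fintype.card ι : ℝ) * (M * A) := by positivity
      have f2 : 0 ≤ M * I := by positivity
      linarith

theorem exists_pos_mul_le_rpow_mul_le (L K : ℝ) (hp : 0 < p) :
    ∃ ε > 0, ε * L ≤ 1 / 2 ∧ K * ε ^ p ≤ 1 / 2 := by
  have h1 : Tendsto (fun ε : ℝ => ε * L) (𝓝[>] 0) (𝓝 (0 * L)) :=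
    (tendsto_id.mono_left nhdsWithin_le_nhds).mul_const L
  have h2 : Tendsto (fun ε : ℝ => K * ε ^ p) (𝓝[>] 0) (𝓝 (K * 0 ^ p)) :=
    (((Real.continuous_rpow_const hp.le).tendsto 0).mono_left nhdsWithin_le_nhds).const_mul K
  rw [zero_mul] at h1
  rw [Real.zero_rpow hp.ne', mul_zero] at h2
  have e1 := h1.eventually (ge_mem_nhds (by norm_num : (0 : ℝ) < 1 / 2))
  have e2 := h2.eventually (ge_mem_nhds (by norm_num : (0 : ℝ) < 1 / 2))
  obtain ⟨ε, ⟨h3, h4⟩, h5⟩ := ((e1.and e2).and eventually_mem_nhdsWithin).exists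
  exact ⟨ε, h5, h3, h4⟩

/-- The interior second derivative estimate with a cutoff function. -/
theorem exists_integral_cutoff_rpow_le (b : OrthonormalBasis ι ℝ E) (hp : 1 < p)
    (hη : IsTest η) (hη0 : ∀ x, 0 ≤ η x) (hη1 : ∀ x, η x ≤ 1) : ∃ C ≥ 0, ∀ z : E → ℝ,
      ContDiff ℝ 2 z → ∀ j k, ∫ x, (η x ^ 2 * |dirDeriv (b k) (dirDeriv (b j) z) x|) ^ p
        ≤ C * ((∫ x in tsupport η, |basisLaplacian b z x| ^ p)
          + ∫ x in tsupport η, |z x| ^ p) := by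
  have hp0 : 0 < p := by linarith
  have hθ : IsTest fun x => η x ^ 2 := ⟨hη.contDiff.pow 2, hη.hasCompactSupport.comp_left
    (g := fun t : ℝ => t ^ 2) (by norm_num)⟩
  have hθ2 : ContDiff ℝ 2 fun x => η x ^ 2 := contDiff_infty.1 hθ.contDiff 2
  obtain ⟨c, hc0, hc⟩ := exists_integral_lowerOrder_rpow_le b hp hη hη0
  obtain ⟨M, hM0, hM⟩ := exists_abs_localization_le b hη hη0 hη1
  obtain ⟨G, hG0, hG⟩ := exists_integral_rpow_dirDeriv_dirDeriv_le b hp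
  obtain ⟨L, hL⟩ := (hη.contDiff.of_le (by simp) : ContDiff ℝ 1 η).lipschitzWith_of_hasCompactSupport
    hη.hasCompactSupport (by norm_num)
  have hLip : ∀ x y, |η x - η y| ≤ L * ‖x - y‖ := fun x y => by
    simpa [dist_eq_norm] using hL.dist_le_mul x y
  set d := Module.finrank ℝ E
  set n : ℝ := (Fintype.card ι : ℝ) with hn
  have hn0 : 0 ≤ n := Nat.cast_nonneg _
  set K := 2 ^ p * (G * 2 ^ p * (1 + M ^ p * c) + M ^ p * c) with hK
  have hMp : 0 ≤ M ^ p := Real.rpow_nonneg hM0 p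
  have hK0 : 0 ≤ K := by positivity
  set A : ℝ := 4 ^ p * (2 ^ d + 1) with hA
  set B : ℝ := 4 ^ p * (4 ^ p * 2 ^ d) with hB
  have hA0 : 0 ≤ A := by positivity
  have hB0 : 0 ≤ B := by positivity
  obtain ⟨ε, hε, hεL, hεK⟩ := exists_pos_mul_le_rpow_mul_le (L : ℝ) (B * n * K) hp0
  set δ := ε ^ p with hδ
  have hδ0 : 0 < δ := by positivity
  refine ⟨K * (2 + 2 * (n * A / δ)), by positivity, fun z hz => ?_⟩
  set F := ∫ x in tsupport η, |basisLaplacian b z x| ^ p with hF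
  set V := ∫ x in tsupport η, |z x| ^ p with hV
  set Γ := ∑ i, ∫ x, (η x * |dirDeriv (b i) z x|) ^ p with hΓ
  have hF0 : 0 ≤ F := integral_nonneg fun x => by positivity
  have hV0 : 0 ≤ V := integral_nonneg fun x => by positivity
  have hΓ0 : 0 ≤ Γ := Finset.sum_nonneg fun i _ => integral_nonneg fun x =>
    Real.rpow_nonneg (mul_nonneg (hη0 x) (abs_nonneg _)) p
  have hlo := fun x => lowerOrder_nonneg (b := b) (z := z) hη0 x
  obtain ⟨hSi, hSle⟩ := hc z hz
  set u : E → ℝ := fun x => η x ^ 2 * z x with hu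
  have hu2 : ContDiff ℝ 2 u := hθ2.mul hz
  have hus : HasCompactSupport u := hθ.hasCompactSupport.mul_right
  have hLi := integrable_indicator_rpow (continuous_basisLaplacian (b := b) hz)
    hη.hasCompactSupport hp0.le
  have hLap : ∫ x, |basisLaplacian b u x| ^ p
      ≤ 2 ^ p * (F + M ^ p * ∫ x, lowerOrder b η z x ^ p) := by
    have : 2 ^ p * (F + M ^ p * ∫ x, lowerOrder b η z x ^ p)
        = ∫ x, 2 ^ p * ((tsupport η).indicator (fun x => |basisLaplacian b z x| ^ p) x
          + M ^ p * lowerOrder b η z x ^ p) := by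
      rw [integral_const_mul, integral_add hLi (hSi.const_mul _), integral_const_mul,
        integral_indicator hη.hasCompactSupport.measurableSet]
    rw [this]
    refine integral_mono_of_nonneg (ae_of_all _ fun x => by positivity)
      ((hLi.add (hSi.const_mul _)).const_mul _) (ae_of_all _ fun x => ?_)
    have h0 := indicator_nonneg (s := tsupport η) (f := fun x => |basisLaplacian b z x|)
      (fun _ _ => abs_nonneg _) x
    have h1 := Real.rpow_le_rpow (abs_nonneg _) (hM z hz x).2 hp0.le
    have h2 := add_rpow_le_two_rpow_mul h0 (mul_nonneg hM0 (hlo x)) hp0.le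
    rw [Real.mul_rpow hM0 (hlo x), indicator_rpow_eq hp0] at h2
    exact h1.trans h2
  have hX : ∀ j k, ∫ x, (η x ^ 2 * |dirDeriv (b k) (dirDeriv (b j) z) x|) ^ p
      ≤ K * (F + Γ + V) := by
    intro j k
    have hDc : Continuous (dirDeriv (b k) (dirDeriv (b j) u)) :=
      continuous_dirDeriv (contDiff_dirDeriv hu2 _) _
    have hDi : Integrable fun x => |dirDeriv (b k) (dirDeriv (b j) u) x| ^ p := by
      refine (hDc.abs.rpow_const fun _ => Or.inr hp0.le).integrable_of_hasCompactSupport ?_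
      exact (hasCompactSupport_dirDeriv (hasCompactSupport_dirDeriv hus _) _).comp_left
        (g := fun t : ℝ => |t| ^ p) (by simp [Real.zero_rpow hp0.ne'])
    have h1 : ∫ x, (η x ^ 2 * |dirDeriv (b k) (dirDeriv (b j) z) x|) ^ p
        ≤ 2 ^ p * ((∫ x, |dirDeriv (b k) (dirDeriv (b j) u) x| ^ p)
          + M ^ p * ∫ x, lowerOrder b η z x ^ p) := by
      rw [← integral_const_mul, ← integral_add hDi (hSi.const_mul _), ← integral_const_mul]
      refine integral_mono_of_nonneg (ae_of_all _ fun x => by positivity)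
        ((hDi.add (hSi.const_mul _)).const_mul _) (ae_of_all _ fun x => ?_)
      have h1 := Real.rpow_le_rpow (by positivity) ((hM z hz x).1 j k) hp0.le
      have h2 := add_rpow_le_two_rpow_mul
        (abs_nonneg (dirDeriv (b k) (dirDeriv (b j) u) x)) (mul_nonneg hM0 (hlo x)) hp0.le
      rw [Real.mul_rpow hM0 (hlo x)] at h2
      exact h1.trans h2
    calc _ ≤ 2 ^ p * (G * (2 ^ p * (F + M ^ p * (c * (Γ + V)))) + M ^ p * (c * (Γ + V))) := by
          refine h1.trans ?_
          have h2 := hG u hu2 hus j k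
          have h3 : ∫ x, |basisLaplacian b u x| ^ p ≤ 2 ^ p * (F + M ^ p * (c * (Γ + V))) :=
            hLap.trans (by gcongr)
          gcongr
          exact h2.trans (by gcongr)
      _ ≤ K * (F + Γ + V) := by
          have e : K * (F + Γ + V) - 2 ^ p * (G * (2 ^ p * (F + M ^ p * (c * (Γ + V))))
              + M ^ p * (c * (Γ + V)))
              = 2 ^ p * (G * 2 ^ p * (Γ + V + M ^ p * c * F) + M ^ p * c * F) := by
            rw [hK]; ring
          have : 0 ≤ 2 ^ p * (G * 2 ^ p * (Γ + V + M ^ p * c * F) + M ^ p * c * F) := by positivity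
          linarith
  have hgrad : δ * Γ ≤ n * A * V + δ / 2 * (F + Γ + V) := by
    have h1 : ∀ i, δ * ∫ x, (η x * |dirDeriv (b i) z x|) ^ p
        ≤ A * V + B * δ ^ 2 * (K * (F + Γ + V)) := by
      intro i
      have h2 := integral_rpow_mul_abs_dirDeriv_le hp.le hz hLip hη0 hη.continuous
        hη.hasCompactSupport L.2 (b.orthonormal.1 i).le hε hεL
      have h3 : ∫ x in {x | 0 < η x}, |z x| ^ p ≤ V := by
        refine setIntegral_mono_set ?_ (ae_of_all _ fun x => by positivity)
          (LE.le.eventuallyLE fun x hx => subset_closure (ne_of_gt hx))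
        exact (hz.continuous.abs.rpow_const fun _ =>
          Or.inr hp0.le).continuousOn.integrableOn_compact hη.hasCompactSupport
      have h4 : (4 * ε ^ 2) ^ p = 4 ^ p * δ ^ 2 := by
        rw [Real.mul_rpow (by norm_num) (by positivity), hδ, ← Real.rpow_natCast,
          ← Real.rpow_natCast, ← Real.rpow_mul hε.le, ← Real.rpow_mul hε.le, mul_comm p]
      rw [h4] at h2
      refine h2.trans ?_
      calc 4 ^ p * ((2 ^ d + 1) * (∫ x in {x | 0 < η x}, |z x| ^ p) + 4 ^ p * δ ^ 2 * (2 ^ d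
            * ∫ x, (η x ^ 2 * |dirDeriv (b i) (dirDeriv (b i) z) x|) ^ p))
          ≤ 4 ^ p * ((2 ^ d + 1) * V + 4 ^ p * δ ^ 2 * (2 ^ d * (K * (F + Γ + V)))) := by
            have := hX i i
            gcongr
        _ = _ := by rw [hA, hB]; ring
    calc δ * Γ = ∑ i, δ * ∫ x, (η x * |dirDeriv (b i) z x|) ^ p := by rw [hΓ, Finset.mul_sum]
      _ ≤ ∑ i : ι, (A * V + B * δ ^ 2 * (K * (F + Γ + V))) := Finset.sum_le_sum fun i _ => h1 i
      _ = n * A * V + δ * ((B * n * K * δ) * (F + Γ + V)) := by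
          rw [Finset.sum_const, Finset.card_univ, nsmul_eq_mul]; ring
      _ ≤ n * A * V + δ * (1 / 2 * (F + Γ + V)) := by gcongr
      _ = _ := by ring
  have hΓle : Γ ≤ F + V + 2 * (n * A / δ) * V := by
    have h1 : δ * Γ ≤ δ * (F + V + 2 * (n * A / δ) * V) := by
      have : δ * (F + V + 2 * (n * A / δ) * V) = δ * (F + V) + 2 * (n * A * V) := by
        field_simp
      rw [this]; linarith
    exact le_of_mul_le_mul_left h1 hδ0
  intro j k
  refine (hX j k).trans ?_
  rw [mul_assoc K (2 + 2 * (n * A / δ))]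
  refine mul_le_mul_of_nonneg_left ?_ hK0
  have : 0 ≤ 2 * (n * A / δ) * F := by positivity
  linarith

end InteriorEstimate

section Annulus

variable {E : Type*} [NormedAddCommGroup E] [InnerProductSpace ℝ E] [FiniteDimensional ℝ E]
  [MeasurableSpace E] [BorelSpace E] {ι : Type*} [Fintype ι] {b : OrthonormalBasis ι ℝ E}

theorem exists_isTest_one_of_isCompact {K U : Set E} (hK : IsCompact K) (hU : IsOpen U)
    (hKU : K ⊆ U) : ∃ χ : E → ℝ, IsTest χ ∧ (∀ x, 0 ≤ χ x) ∧ (∀ x, χ x ≤ 1) ∧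
      (∀ x ∈ K, χ x = 1) ∧ tsupport χ ⊆ U := by
  obtain ⟨L, hL, hKL, hLU⟩ := exists_compact_between hK hU hKU
  obtain ⟨f, hf, hf01, hfs, hf1⟩ := exists_contMDiff_support_eq_eq_one_iff
    (modelWithCornersSelf ℝ E) (n := ⊤) (isOpen_interior (s := L)) hK.isClosed hKL
  have hsub : tsupport f ⊆ L := by
    rw [tsupport, hfs]
    exact closure_minimal interior_subset hL.isClosed
  exact ⟨f, ⟨hf.contDiff, hL.of_isClosed_subset (isClosed_tsupport f) hsub⟩,
    fun x => (hf01 (mem_range_self x)).1, fun x => (hf01 (mem_range_self x)).2,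
    fun x hx => (hf1 x).1 hx, hsub.trans hLU⟩

theorem contDiff_mul_of_tsupport_subset {χ z : E → ℝ} {U : Set E} (hχ : ContDiff ℝ 2 χ)
    (hχU : tsupport χ ⊆ U) (hU : IsOpen U) (hz : ContDiffOn ℝ 2 z U) :
    ContDiff ℝ 2 fun x => χ x * z x := by
  refine contDiff_iff_contDiffAt.2 fun x => ?_
  by_cases hx : x ∈ U
  · exact hχ.contDiffAt.mul (hz.contDiffAt (hU.mem_nhds hx))
  · have h : (fun x => χ x * z x) =ᶠ[𝓝 x] fun _ => 0 := by
      filter_upwards [notMem_tsupport_iff_eventuallyEq.1 fun h => hx (hχU h)] with y hy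
      simp [hy]
    exact contDiffAt_const.congr_of_eventuallyEq h

theorem dirDeriv_dirDeriv_eq_iteratedFDeriv {z : E → ℝ} (hz : ContDiff ℝ 2 z) (v w x : E) :
    dirDeriv v (dirDeriv w z) x = iteratedFDeriv ℝ 2 z x ![v, w] := by
  have h : DifferentiableAt ℝ (fderiv ℝ z) x :=
    (hz.fderiv_right (m := 1) (by norm_num)).differentiable (by norm_num) x
  rw [iteratedFDeriv_two_apply]
  change fderiv ℝ (fun y => fderiv ℝ z y w) x v = _
  rw [fderiv_clm_apply h (differentiableAt_const w)]
  simp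

theorem norm_iteratedFDeriv_two_le (b : OrthonormalBasis ι ℝ E) {z : E → ℝ} (hz : ContDiff ℝ 2 z)
    (x : E) : ‖iteratedFDeriv ℝ 2 z x‖
      ≤ ∑ q : ι × ι, |dirDeriv (b q.2) (dirDeriv (b q.1) z) x| := by
  refine ContinuousMultilinearMap.opNorm_le_bound
    (Finset.sum_nonneg fun _ _ => abs_nonneg _) fun m => ?_
  have h0 : iteratedFDeriv ℝ 2 z x m = ∑ q : ι × ι, (inner ℝ (b q.2) (m 0) *
      inner ℝ (b q.1) (m 1)) * dirDeriv (b q.2) (dirDeriv (b q.1) z) x := by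
    simp only [dirDeriv_dirDeriv_eq_iteratedFDeriv hz, iteratedFDeriv_two_apply,
      Matrix.cons_val_zero, Matrix.cons_val_one]
    conv_lhs => rw [← b.sum_repr' (m 0), ← b.sum_repr' (m 1)]
    simp only [map_sum, map_smul, _root_.sum_apply, _root_.smul_apply,
      smul_eq_mul, Finset.mul_sum, Fintype.sum_prod_type]
    refine Finset.sum_congr rfl fun i _ => Finset.sum_congr rfl fun j _ => ?_
    ring
  rw [h0, Finset.sum_mul]
  refine (Finset.abs_sum_le_sum_abs _ _).trans (Finset.sum_le_sum fun q _ => ?_)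
  rw [abs_mul, abs_mul, mul_comm, Fin.prod_univ_two]
  have h1 : ∀ i y, |inner ℝ (b i) y| ≤ ‖y‖ := fun i y => by
    simpa [b.orthonormal.1 i] using abs_real_inner_le_norm (b i) y
  have := h1 q.2 (m 0)
  have := h1 q.1 (m 1)
  gcongr

theorem iteratedFDeriv_two_comp_smul {F : Type*} [NormedAddCommGroup F] [NormedSpace ℝ F]
    (c : ℝ) (z : E → F) (x : E) :
    iteratedFDeriv ℝ 2 (fun x => z (c • x)) x = c ^ 2 • iteratedFDeriv ℝ 2 z (c • x) := by
  ext m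
  have h1 : fderiv ℝ (fun x => z (c • x)) = fun x => c • fderiv ℝ z (c • x) := by
    ext1 x
    exact fderiv_comp_smul c
  rw [_root_.smul_apply, iteratedFDeriv_two_apply, iteratedFDeriv_two_apply, h1]
  have h2 : fderiv ℝ (fun x => c • fderiv ℝ z (c • x)) x = c • c • fderiv ℝ (fderiv ℝ z) (c • x) :=
    (congrFun (fderiv_const_smul_field (f := fun x => fderiv ℝ z (c • x)) c) x).trans
      (congrArg (c • ·) (fderiv_comp_smul (f := fderiv ℝ z) (x := x) c))
  rw [h2]
  simp [pow_two, mul_smul]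

variable (E) in
theorem isCompact_annulus (r s : ℝ) : IsCompact {x : E | r ≤ ‖x‖ ∧ ‖x‖ ≤ s} := by
  refine (isCompact_closedBall (0 : E) s).of_isClosed_subset ?_ fun x hx => by simpa using hx.2
  exact (isClosed_le continuous_const continuous_norm).inter
    (isClosed_le continuous_norm continuous_const)

variable (E) in
theorem isOpen_annulus (r s : ℝ) : IsOpen {x : E | r < ‖x‖ ∧ ‖x‖ < s} :=
  (isOpen_lt continuous_const continuous_norm).inter (isOpen_lt continuous_norm continuous_const)

theorem exists_integral_annulus_le (b : OrthonormalBasis ι ℝ E) {p : ℝ} (hp : 1 < p) :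
    ∃ C > 0, ∀ z : E → ℝ, ContDiff ℝ 2 z →
      ∫ x in {x : E | 1 / 2 < ‖x‖ ∧ ‖x‖ < 1}, ‖iteratedFDeriv ℝ 2 z x‖ ^ p
        ≤ C * ((∫ x in {x : E | 1 / 4 < ‖x‖ ∧ ‖x‖ < 2}, |basisLaplacian b z x| ^ p)
          + ∫ x in {x : E | 1 / 4 < ‖x‖ ∧ ‖x‖ < 2}, |z x| ^ p) := by
  have hp0 : 0 < p := by linarith
  obtain ⟨η, hη, hη0, hη1, hηK, hηU⟩ := exists_isTest_one_of_isCompact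
    (isCompact_annulus E (1 / 2) 1) (isOpen_annulus E (1 / 4) 2) fun x hx =>
      ⟨by linarith [hx.1], by linarith [hx.2]⟩
  obtain ⟨C, hC0, hC⟩ := exists_integral_cutoff_rpow_le b hp hη hη0 hη1
  set m : ℝ := (Fintype.card (ι × ι) : ℝ) with hm
  have hm0 : 0 ≤ m := Nat.cast_nonneg _
  refine ⟨m ^ (p - 1) * (m * C) + 1, by positivity, fun z hz => ?_⟩
  set S := {x : E | 1 / 2 < ‖x‖ ∧ ‖x‖ < 1}
  set T := {x : E | 1 / 4 < ‖x‖ ∧ ‖x‖ < 2} with hT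
  have hS : MeasurableSet S := (isOpen_annulus E (1 / 2) 1).measurableSet
  have hmono : ∀ f : E → ℝ, Continuous f →
      ∫ x in tsupport η, |f x| ^ p ≤ ∫ x in T, |f x| ^ p := fun f hf => by
    refine setIntegral_mono_set ?_ (ae_of_all _ fun x => by positivity) (LE.le.eventuallyLE hηU)
    exact ((hf.abs.rpow_const fun _ => Or.inr hp0.le).continuousOn.integrableOn_compact
      (isCompact_annulus E (1 / 4) 2)).mono_set fun x hx => ⟨hx.1.le, hx.2.le⟩
  have hB := add_le_add (hmono _ (continuous_basisLaplacian (b := b) hz)) (hmono _ hz.continuous)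
  set D := (∫ x in T, |basisLaplacian b z x| ^ p) + ∫ x in T, |z x| ^ p
  have hD0 : 0 ≤ D := add_nonneg (integral_nonneg fun x => by positivity)
    (integral_nonneg fun x => by positivity)
  have hi : ∀ q : ι × ι, Integrable fun x =>
      (η x ^ 2 * |dirDeriv (b q.2) (dirDeriv (b q.1) z) x|) ^ p := fun q => by
    have hc : Continuous fun x => η x ^ 2 * |dirDeriv (b q.2) (dirDeriv (b q.1) z) x| :=
      (hη.continuous.pow 2).mul (continuous_dirDeriv (contDiff_dirDeriv hz _) _).abs
    refine (hc.rpow_const fun _ => Or.inr hp0.le).integrable_of_hasCompactSupport ?_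
    exact ((hη.hasCompactSupport.comp_left (g := fun t : ℝ => t ^ 2) (by norm_num)).mul_right).comp_left
      (g := fun t : ℝ => t ^ p) (Real.zero_rpow hp0.ne')
  have hpt : ∀ x ∈ S, ‖iteratedFDeriv ℝ 2 z x‖ ^ p ≤ m ^ (p - 1) *
      ∑ q : ι × ι, (η x ^ 2 * |dirDeriv (b q.2) (dirDeriv (b q.1) z) x|) ^ p := fun x hx => by
    have h1 := Real.rpow_le_rpow (norm_nonneg _) (norm_iteratedFDeriv_two_le b hz x) hp0.le
    have h2 := Real.rpow_sum_le_const_mul_sum_rpow Finset.univ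
      (fun q : ι × ι => dirDeriv (b q.2) (dirDeriv (b q.1) z) x) hp.le
    rw [Finset.card_univ, ← hm] at h2
    rw [hηK x ⟨hx.1.le, hx.2.le⟩]
    simpa only [one_pow, one_mul] using h1.trans h2
  calc ∫ x in S, ‖iteratedFDeriv ℝ 2 z x‖ ^ p
      ≤ ∫ x in S, m ^ (p - 1) *
          ∑ q : ι × ι, (η x ^ 2 * |dirDeriv (b q.2) (dirDeriv (b q.1) z) x|) ^ p :=
        integral_mono_of_nonneg (ae_of_all _ fun x => by positivity)
          ((integrable_finsetSum _ fun q _ => hi q).const_mul _).integrableOn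
          ((ae_restrict_iff' hS).2 (ae_of_all _ hpt))
    _ ≤ ∫ x, m ^ (p - 1) *
          ∑ q : ι × ι, (η x ^ 2 * |dirDeriv (b q.2) (dirDeriv (b q.1) z) x|) ^ p :=
        setIntegral_le_integral ((integrable_finsetSum _ fun q _ => hi q).const_mul _)
          (ae_of_all _ fun x => by positivity)
    _ = m ^ (p - 1) *
          ∑ q : ι × ι, ∫ x, (η x ^ 2 * |dirDeriv (b q.2) (dirDeriv (b q.1) z) x|) ^ p := by
        rw [integral_const_mul, integral_finsetSum _ fun q _ => hi q]
    _ ≤ m ^ (p - 1) * ∑ q : ι × ι, C * D := by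
        gcongr with q
        exact (hC z hz q.1 q.2).trans (mul_le_mul_of_nonneg_left hB hC0)
    _ = m ^ (p - 1) * (m * C) * D := by
        rw [Finset.sum_const, Finset.card_univ, nsmul_eq_mul]; ring
    _ ≤ _ := by nlinarith

open scoped Pointwise in
theorem smul_annulus {R : ℝ} (hR : 0 < R) (r s : ℝ) :
    R • {x : E | r < ‖x‖ ∧ ‖x‖ < s} = {x : E | R * r < ‖x‖ ∧ ‖x‖ < R * s} := by
  ext x
  rw [mem_smul_set_iff_inv_smul_mem₀ hR.ne', mem_ofPred_eq, mem_ofPred_eq, norm_smul, norm_inv,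
    Real.norm_of_nonneg hR.le, lt_inv_mul_iff₀ hR, inv_mul_lt_iff₀ hR]

theorem lap_eq_basisLaplacian {N : ℕ} {z : EuclideanSpace ℝ (Fin N) → ℝ} (hz : ContDiff ℝ 2 z)
    (x : EuclideanSpace ℝ (Fin N)) :
    lap z x = basisLaplacian (EuclideanSpace.basisFun (Fin N) ℝ) z x := by
  simp [lap, basisLaplacian, dirDeriv_dirDeriv_eq_iteratedFDeriv hz]

theorem lap_comp_smul {N : ℕ} (c : ℝ) (z : EuclideanSpace ℝ (Fin N) → ℝ)
    (x : EuclideanSpace ℝ (Fin N)) : lap (fun x => z (c • x)) x = c ^ 2 * lap z (c • x) := by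
  simp only [lap, iteratedFDeriv_two_comp_smul, _root_.smul_apply, smul_eq_mul,
    Finset.mul_sum]

theorem exists_integral_unit_annulus_le (N : ℕ) {p : ℝ} (hp : 1 < p) :
    ∃ C > 0, ∀ z : EuclideanSpace ℝ (Fin N) → ℝ, ∀ U : Set (EuclideanSpace ℝ (Fin N)), IsOpen U →
      {x : EuclideanSpace ℝ (Fin N) | 1 / 4 ≤ ‖x‖ ∧ ‖x‖ ≤ 2} ⊆ U → ContDiffOn ℝ 2 z U →
      ∫ x in {x : EuclideanSpace ℝ (Fin N) | 1 / 2 < ‖x‖ ∧ ‖x‖ < 1}, ‖iteratedFDeriv ℝ 2 z x‖ ^ p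
        ≤ C * ((∫ x in {x : EuclideanSpace ℝ (Fin N) | 1 / 4 < ‖x‖ ∧ ‖x‖ < 2}, |lap z x| ^ p)
          + ∫ x in {x : EuclideanSpace ℝ (Fin N) | 1 / 4 < ‖x‖ ∧ ‖x‖ < 2}, |z x| ^ p) := by
  obtain ⟨C, hC0, hC⟩ := exists_integral_annulus_le (EuclideanSpace.basisFun (Fin N) ℝ) hp
  refine ⟨C, hC0, fun z U hU hAU hz => ?_⟩
  obtain ⟨χ, hχ, -, -, hχ1, hχU⟩ := exists_isTest_one_of_isCompact
    (isCompact_annulus (EuclideanSpace ℝ (Fin N)) (1 / 4) 2) hU hAU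
  have hw : ContDiff ℝ 2 fun x => χ x * z x :=
    contDiff_mul_of_tsupport_subset (contDiff_infty.1 hχ.contDiff 2) hχU hU hz
  have hT := isOpen_annulus (EuclideanSpace ℝ (Fin N)) (1 / 4) 2
  have heq : ∀ x ∈ {x : EuclideanSpace ℝ (Fin N) | 1 / 4 < ‖x‖ ∧ ‖x‖ < 2},
      (fun x => χ x * z x) =ᶠ[𝓝 x] z := fun x hx => by
    filter_upwards [hT.mem_nhds hx] with y hy
    rw [hχ1 y ⟨hy.1.le, hy.2.le⟩, one_mul]
  have hD : ∀ x ∈ {x : EuclideanSpace ℝ (Fin N) | 1 / 4 < ‖x‖ ∧ ‖x‖ < 2},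
      iteratedFDeriv ℝ 2 (fun x => χ x * z x) x = iteratedFDeriv ℝ 2 z x := fun x hx =>
    ((heq x hx).iteratedFDeriv ℝ 2).eq_of_nhds
  refine (setIntegral_congr_fun (isOpen_annulus _ (1 / 2) 1).measurableSet fun x hx => ?_).trans_le
    ((hC _ hw).trans_eq (congrArg (C * ·) (congrArg₂ (· + ·)
      (setIntegral_congr_fun hT.measurableSet fun x hx => ?_)
      (setIntegral_congr_fun hT.measurableSet fun x hx => ?_))))
  · simp only [hD x ⟨by linarith [hx.1], by linarith [hx.2]⟩]
  · simp only [← lap_eq_basisLaplacian hw, lap, hD x hx]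
  · simp only [(heq x hx).eq_of_nhds]

end Annulus

/-- Lemma 2.2: interior elliptic `L^k`-estimate on an annulus. -/
theorem elliptic_Lk_estimate_annulus
    (N : ℕ) (hN : 1 ≤ N) (k : ℝ) (hk : 1 < k) :
    ∃ C > 0, ∀ R > (0 : ℝ), ∀ z : EuclideanSpace ℝ (Fin N) → ℝ,
      (∃ U : Set (EuclideanSpace ℝ (Fin N)), IsOpen U ∧
        {x : EuclideanSpace ℝ (Fin N) | R / 4 ≤ ‖x‖ ∧ ‖x‖ ≤ 2 * R} ⊆ U ∧
        ContDiffOn ℝ 2 z U) →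
      (∫ x in {x : EuclideanSpace ℝ (Fin N) | R / 2 < ‖x‖ ∧ ‖x‖ < R},
          ‖iteratedFDeriv ℝ 2 z x‖ ^ k)
        ≤ C * ((∫ x in {x : EuclideanSpace ℝ (Fin N) | R / 4 < ‖x‖ ∧ ‖x‖ < 2 * R},
              |lap z x| ^ k)
            + R ^ (-(2 * k)) *
              ∫ x in {x : EuclideanSpace ℝ (Fin N) | R / 4 < ‖x‖ ∧ ‖x‖ < 2 * R},
                |z x| ^ k) := by
  obtain ⟨C, hC0, hC⟩ := exists_integral_unit_annulus_le N hk
  refine ⟨C, hC0, fun R hR z ⟨U, hU, hAU, hz⟩ => ?_⟩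
  have hsm : ContDiff ℝ 2 fun x : EuclideanSpace ℝ (Fin N) => R • x := contDiff_const_smul R
  have h := hC (fun x => z (R • x)) ((fun x => R • x) ⁻¹' U) (hU.preimage hsm.continuous)
    (fun x hx => hAU (by
      simp only [mem_ofPred_eq] at hx
      simp only [mem_ofPred_eq, norm_smul, Real.norm_of_nonneg hR.le]
      constructor <;> nlinarith [hx.1, hx.2]))
    (hz.comp hsm.contDiffOn fun x hx => hx)
  have hRk : (R ^ 2) ^ k = R ^ (2 * k) := by
    rw [Real.rpow_mul hR.le, Real.rpow_two]
  have hd : 0 < |(R ^ Module.finrank ℝ (EuclideanSpace ℝ (Fin N)))⁻¹| := by positivity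
  have hR2 : 0 < R ^ (2 * k) := by positivity
  have e1 : ∀ x, ‖iteratedFDeriv ℝ 2 (fun x => z (R • x)) x‖ ^ k
      = R ^ (2 * k) * ‖iteratedFDeriv ℝ 2 z (R • x)‖ ^ k := fun x => by
    rw [iteratedFDeriv_two_comp_smul, norm_smul, Real.norm_of_nonneg (by positivity),
      Real.mul_rpow (by positivity) (norm_nonneg _), hRk]
  have e2 : ∀ x, |lap (fun x => z (R • x)) x| ^ k = R ^ (2 * k) * |lap z (R • x)| ^ k := fun x => by
    rw [lap_comp_smul, abs_mul, abs_of_nonneg (by positivity : 0 ≤ R ^ 2),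
      Real.mul_rpow (by positivity) (abs_nonneg _), hRk]
  simp only [e1, e2, integral_const_mul] at h
  rw [Measure.setIntegral_comp_smul volume (fun x => ‖iteratedFDeriv ℝ 2 z x‖ ^ k) _ hR.ne',
    Measure.setIntegral_comp_smul volume (fun x => |lap z x| ^ k) _ hR.ne',
    Measure.setIntegral_comp_smul volume (fun x => |z x| ^ k) _ hR.ne',
    smul_annulus hR, smul_annulus hR] at h
  simp only [smul_eq_mul] at h
  rw [mul_one, mul_one_div, mul_one_div, mul_comm R 2] at h
  refine le_of_mul_le_mul_left (h.trans_eq' ?_ |>.trans_eq ?_) (mul_pos hR2 hd)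
  · ring
  · rw [Real.rpow_neg hR.le]
    field_simp
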